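/- arXiv:math/0602371 — 8 statements merged into one kernel-verified Lean document; each statement's English description precedes it below -/
import Mathlib

section
/- Let n ≥ 1 and let D ⊆ ℂ^n be the set of parameters u = (u_0, …, u_{n−1}) such that the polynomial x^{n+1} + u_{n−1}x^{n−1} + ⋯ + u_1 x + u_0 has a multiple complex root, i.e. a common root with its derivative. Then for every basepoint u₀ ∈ ℂ^n ∖ D the fundamental group π₁(ℂ^n ∖ D, u₀) is isomorphic to the Artin braid group on n+1 strands, i.e. to the group presented by generators t_1, …, t_n and relations t_i t_{i+1} t_i = t_{i+1} t_i t_{i+1} for 1 ≤ i ≤ n−1 and t_i t_j = t_j t_i for |i − j| > 1. -/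
namespace Stmt1

open FreeGroup Polynomial

/-- The Artin braid relations on generators `t_0, …, t_{n-1}` (0-indexed): the braid
relation for neighbours and commutation for `|i − j| > 1`. -/
def artinRels (n : ℕ) : Set (FreeGroup (Fin n)) :=
  { r | (∃ i j : Fin n, (i : ℕ) + 1 = (j : ℕ) ∧
          r = of i * of j * of i * (of j * of i * of j)⁻¹) ∨
        (∃ i j : Fin n, (i : ℕ) + 1 < (j : ℕ) ∧ r = of i * of j * (of j * of i)⁻¹) }

/-- The polynomial `x^{n+1} + u_{n−1} x^{n−1} + ⋯ + u_1 x + u_0`. -/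
noncomputable def unfPoly (n : ℕ) (u : Fin n → ℂ) : Polynomial ℂ :=
  X ^ (n + 1) + ∑ i : Fin n, C (u i) * X ^ (i : ℕ)

/-- The discriminant: parameters `u` for which the polynomial has a multiple complex root,
i.e. a common root with its derivative. -/
def Discr (n : ℕ) : Set (Fin n → ℂ) :=
  { u | ∃ y : ℂ, (unfPoly n u).eval y = 0 ∧ ((unfPoly n u).derivative).eval y = 0 }

section

open CategoryTheory

variable {n : ℕ}

/-- The Artin braid group on `n + 1` strands. -/
abbrev Braid (n : ℕ) : Type := PresentedGroup (artinRels n)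

/-- The standard generators of the braid group. -/
def braidGen (i : Fin n) : Braid n := PresentedGroup.of i

theorem braidGen_braid {i j : Fin n} (h : (i : ℕ) + 1 = j) :
    braidGen i * braidGen j * braidGen i = braidGen j * braidGen i * braidGen j := by
  have := PresentedGroup.one_of_mem (rels := artinRels n) (Or.inl ⟨i, j, h, rfl⟩)
  exact mul_inv_eq_one.mp this

theorem braidGen_comm {i j : Fin n} (h : (i : ℕ) + 1 < j) :
    braidGen i * braidGen j = braidGen j * braidGen i := by
  have := PresentedGroup.one_of_mem (rels := artinRels n) (Or.inr ⟨i, j, h, rfl⟩)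
  exact mul_inv_eq_one.mp this

/-- The adjacent transposition exchanging `i` and `i + 1`. -/
def adjSwap (i : Fin n) : Equiv.Perm (Fin (n + 1)) := Equiv.swap i.castSucc i.succ

@[simp] theorem adjSwap_castSucc (i : Fin n) : adjSwap i i.castSucc = i.succ :=
  Equiv.swap_apply_left _ _

@[simp] theorem adjSwap_succ (i : Fin n) : adjSwap i i.succ = i.castSucc :=
  Equiv.swap_apply_right _ _

@[simp] theorem adjSwap_mul_self (i : Fin n) : adjSwap i * adjSwap i = 1 :=
  Equiv.swap_mul_self _ _

@[simp] theorem mul_adjSwap_mul_self (w : Equiv.Perm (Fin (n + 1))) (i : Fin n) :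
    w * adjSwap i * adjSwap i = w := by
  rw [mul_assoc, adjSwap_mul_self, mul_one]

@[simp] theorem adjSwap_inv (i : Fin n) : (adjSwap i)⁻¹ = adjSwap i :=
  Equiv.swap_inv _ _

@[simp] theorem adjSwap_adjSwap (i : Fin n) (a : Fin (n + 1)) :
    adjSwap i (adjSwap i a) = a :=
  Equiv.swap_apply_self _ _ _

theorem adjSwap_of_ne {i : Fin n} {a : Fin (n + 1)} (h₁ : (a : ℕ) ≠ i) (h₂ : (a : ℕ) ≠ i + 1) :
    adjSwap i a = a :=
  Equiv.swap_apply_of_ne_of_ne (by simpa [Fin.ext_iff] using h₁) (by simpa [Fin.ext_iff] using h₂)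

theorem adjSwap_comm {i j : Fin n} (h : (i : ℕ) + 1 < j) :
    adjSwap i * adjSwap j = adjSwap j * adjSwap i := by
  refine Equiv.Perm.Disjoint.commute ?_
  intro a
  by_cases h₁ : (a : ℕ) = i ∨ (a : ℕ) = i + 1
  · exact Or.inr (adjSwap_of_ne (by omega) (by omega))
  · exact Or.inl (adjSwap_of_ne (by omega) (by omega))

theorem adjSwap_braid {i j : Fin n} (h : (i : ℕ) + 1 = j) :
    adjSwap i * adjSwap j * adjSwap i = adjSwap j * adjSwap i * adjSwap j := by
  have hij : i.succ = j.castSucc := by simp [Fin.ext_iff, h]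
  have h₁ : i.succ ≠ i.castSucc := by simp [Fin.ext_iff]
  have h₂ : j.succ ≠ i.castSucc := by simp [Fin.ext_iff]; omega
  have h₃ : j.succ ≠ i.succ := by simp [Fin.ext_iff]; omega
  have e₁ := Equiv.swap_mul_swap_mul_swap h₃ h₂
  have e₂ := Equiv.swap_mul_swap_mul_swap h₁.symm h₂.symm
  unfold adjSwap
  rw [← hij, e₂, Equiv.swap_comm i.castSucc i.succ, Equiv.swap_comm i.succ j.succ, e₁,
    Equiv.swap_comm]

theorem adjSwap_lt {i : Fin n} {a b : Fin (n + 1)} (h : a < b) :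
    adjSwap i a < adjSwap i b ∨ a = i.castSucc ∧ b = i.succ := by
  unfold adjSwap
  rw [Equiv.swap_apply_def, Equiv.swap_apply_def]
  simp only [Fin.ext_iff, Fin.val_castSucc, Fin.val_succ, Fin.lt_def] at h ⊢
  split_ifs <;> (try simp only [Fin.val_castSucc, Fin.val_succ]) <;> omega

/-- The number of inversions of a permutation. -/
def invCount (w : Equiv.Perm (Fin (n + 1))) : ℕ :=
  (Finset.univ.filter fun p : Fin (n + 1) × Fin (n + 1) => p.1 < p.2 ∧ w p.2 < w p.1).card

theorem invCount_mul_adjSwap_lt {w : Equiv.Perm (Fin (n + 1))} {i : Fin n}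
    (h : w i.succ < w i.castSucc) : invCount (w * adjSwap i) < invCount w := by
  unfold invCount
  refine lt_of_le_of_lt (Finset.card_le_card_of_injOn (t := (Finset.univ.filter
      fun p : Fin (n + 1) × Fin (n + 1) => p.1 < p.2 ∧ w p.2 < w p.1).erase (i.castSucc, i.succ))
    (fun p => (adjSwap i p.1, adjSwap i p.2)) ?_ ?_) (Finset.card_erase_lt_of_mem ?_)
  · rintro ⟨a, b⟩ hab
    obtain ⟨hab, hw⟩ := (Finset.mem_filter.mp hab).2
    simp only [Finset.mem_coe, Finset.mem_erase, Finset.mem_filter, Finset.mem_univ, true_and,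
      ne_eq, Prod.mk.injEq, not_and]
    rcases adjSwap_lt (i := i) hab with h' | ⟨rfl, rfl⟩
    · refine ⟨fun h₁ h₂ => ?_, h', hw⟩
      have h₃ : a = i.succ := by rw [← adjSwap_adjSwap i a, h₁, adjSwap_castSucc]
      have h₄ : b = i.castSucc := by rw [← adjSwap_adjSwap i b, h₂, adjSwap_succ]
      subst h₃ h₄
      exact absurd hab i.castSucc_lt_succ.not_gt
    · exact absurd hw (by simpa using h.le)
  · rintro ⟨a, b⟩ _ ⟨c, d⟩ _ hp
    simpa using hp
  · simp [h]

theorem eq_one_of_forall_lt {w : Equiv.Perm (Fin (n + 1))}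
    (h : ∀ i : Fin n, w i.castSucc < w i.succ) : w = 1 := by
  have h₁ : StrictMono w := Fin.strictMono_iff_lt_succ.mpr h
  exact DFunLike.coe_injective ((h₁.range_inj strictMono_id).mp (by simp))

theorem exists_descent {w : Equiv.Perm (Fin (n + 1))} (h : w ≠ 1) :
    ∃ i : Fin n, w i.succ < w i.castSucc := by
  by_contra! hw
  exact h (eq_one_of_forall_lt fun i => lt_of_le_of_ne (hw i) (by simp [Fin.ext_iff]))

/-- Every permutation arises from the identity by successively multiplying with adjacent
transpositions that increase the number of inversions. -/
theorem perm_ascent_induction {motive : Equiv.Perm (Fin (n + 1)) → Prop} (one : motive 1)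
    (mul : ∀ w i, w i.castSucc < w i.succ → motive w → motive (w * adjSwap i))
    (w : Equiv.Perm (Fin (n + 1))) : motive w := by
  induction hk : invCount w using Nat.strong_induction_on generalizing w with
  | _ k ih =>
    by_cases hw : w = 1
    · exact hw ▸ one
    · obtain ⟨i, hi⟩ := exists_descent hw
      have := mul (w * adjSwap i) i (by simpa using hi)
        (ih _ (hk ▸ invCount_mul_adjSwap_lt hi) _ rfl)
      simpa using this

open Classical in
/-- The positive lift of a permutation to the braid group. -/
noncomputable def braidLift (w : Equiv.Perm (Fin (n + 1))) : Braid n :=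
  if h : ∃ i : Fin n, w i.succ < w i.castSucc then
    braidLift (w * adjSwap h.choose) * braidGen h.choose
  else 1
termination_by invCount w
decreasing_by exact invCount_mul_adjSwap_lt h.choose_spec

@[simp] theorem braidLift_one : braidLift (1 : Equiv.Perm (Fin (n + 1))) = 1 := by
  rw [braidLift, dif_neg]
  simpa using fun i : Fin n => i.castSucc_lt_succ.le

theorem braidLift_eq_of_descent (w : Equiv.Perm (Fin (n + 1))) {i : Fin n}
    (hi : w i.succ < w i.castSucc) :
    braidLift w = braidLift (w * adjSwap i) * braidGen i := by
  induction hk : invCount w using Nat.strong_induction_on generalizing w i with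
  | _ k ih =>
    subst hk
    have key : ∀ {i j : Fin n}, (i : ℕ) < j → w i.succ < w i.castSucc → w j.succ < w j.castSucc →
        braidLift (w * adjSwap i) * braidGen i = braidLift (w * adjSwap j) * braidGen j := by
      intro i j hij hi hj
      have li := invCount_mul_adjSwap_lt hi
      have lj := invCount_mul_adjSwap_lt hj
      rcases Nat.lt_or_ge (i + 1) j with h | h
      · have e₁ : adjSwap i j.castSucc = j.castSucc :=
          adjSwap_of_ne (by simp; omega) (by simp; omega)
        have e₂ : adjSwap i j.succ = j.succ := adjSwap_of_ne (by simp; omega) (by simp; omega)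
        have e₃ : adjSwap j i.castSucc = i.castSucc :=
          adjSwap_of_ne (by simp; omega) (by simp; omega)
        have e₄ : adjSwap j i.succ = i.succ := adjSwap_of_ne (by simp; omega) (by simp; omega)
        rw [ih _ li (w * adjSwap i) (i := j) (by simpa [e₁, e₂] using hj) rfl,
          ih _ lj (w * adjSwap j) (i := i) (by simpa [e₃, e₄] using hi) rfl,
          mul_assoc w, mul_assoc w, adjSwap_comm h, mul_assoc, mul_assoc, braidGen_comm h]
      · have h : (i : ℕ) + 1 = j := by omega
        have hs : i.succ = j.castSucc := by simp [Fin.ext_iff, h]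
        have e₁ : adjSwap i j.succ = j.succ := adjSwap_of_ne (by simp; omega) (by simp; omega)
        have e₂ : adjSwap j i.castSucc = i.castSucc :=
          adjSwap_of_ne (by simp; omega) (by simp; omega)
        have e₃ : adjSwap i j.castSucc = i.castSucc := by rw [← hs, adjSwap_succ]
        have e₄ : adjSwap j i.succ = j.succ := by rw [hs, adjSwap_castSucc]
        have hj' : w j.succ < w i.succ := by rwa [hs]
        have d₁ : (w * adjSwap i) j.succ < (w * adjSwap i) j.castSucc := by
          simpa [e₁, e₃] using hj'.trans hi
        have d₂ : (w * adjSwap i * adjSwap j) i.succ < (w * adjSwap i * adjSwap j) i.castSucc := by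
          simpa [e₁, e₂, e₄] using hj'
        have d₃ : (w * adjSwap j) i.succ < (w * adjSwap j) i.castSucc := by
          simpa [e₂, e₄] using hj'.trans hi
        have d₄ : (w * adjSwap j * adjSwap i) j.succ < (w * adjSwap j * adjSwap i) j.castSucc := by
          simpa [e₁, e₂, e₃, ← hs] using hi
        rw [ih _ li _ d₁ rfl, ih _ ((invCount_mul_adjSwap_lt d₁).trans li) _ d₂ rfl,
          ih _ lj _ d₃ rfl, ih _ ((invCount_mul_adjSwap_lt d₃).trans lj) _ d₄ rfl]
        simp only [mul_assoc w]
        rw [adjSwap_braid h]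
        simp only [mul_assoc]
        rw [← mul_assoc (braidGen i), braidGen_braid h, mul_assoc]
    have hex : ∃ i : Fin n, w i.succ < w i.castSucc := ⟨i, hi⟩
    have hc := hex.choose_spec
    rw [braidLift, dif_pos hex]
    rcases lt_trichotomy (hex.choose : ℕ) i with h | h | h
    · exact key h hc hi
    · rw [Fin.ext h]
    · exact (key h hi hc).symm

theorem braidLift_mul_adjSwap {w : Equiv.Perm (Fin (n + 1))} {i : Fin n}
    (hi : w i.castSucc < w i.succ) :
    braidLift (w * adjSwap i) = braidLift w * braidGen i := by
  rw [braidLift_eq_of_descent (w * adjSwap i) (i := i) (by simpa using hi), mul_adjSwap_mul_self]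

theorem braidLift_adjSwap (i : Fin n) : braidLift (adjSwap i) = braidGen i := by
  simpa using braidLift_mul_adjSwap (w := 1) (i := i) i.castSucc_lt_succ

/-- The positive lift is multiplicative on products without cancelling inversions. -/
theorem braidLift_mul {u v : Equiv.Perm (Fin (n + 1))}
    (h : ∀ a b, a < b → v b < v a → u (v b) < u (v a)) :
    braidLift (u * v) = braidLift u * braidLift v := by
  induction v using perm_ascent_induction with
  | one => simp
  | mul v i hi ih =>
    have hd : u (v i.castSucc) < u (v i.succ) := by
      simpa using h i.castSucc i.succ i.castSucc_lt_succ (by simpa using hi)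
    rw [braidLift_mul_adjSwap hi, ← mul_assoc, ← mul_assoc, braidLift_mul_adjSwap hd, ih]
    intro a b hab hv
    rcases adjSwap_lt (i := i) hab with h' | ⟨rfl, rfl⟩
    · simpa using h _ _ h' (by simpa using hv)
    · exact absurd hv hi.not_gt

/-- The ordered configurations of `n + 1` distinct complex numbers with sum zero. -/
def confSet (n : ℕ) : Set (Fin (n + 1) → ℂ) :=
  {z | Function.Injective z ∧ ∑ i, z i = 0}

/-- The space of ordered configurations of `n + 1` distinct complex numbers with sum zero. -/
abbrev Conf (n : ℕ) : Type := confSet n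

/-- The complement of the discriminant. -/
abbrev DiscrCompl (n : ℕ) : Type := {u : Fin n → ℂ // u ∉ Discr n}

/-- Permutations act on ordered configurations by relabelling the points. -/
instance : MulAction (Equiv.Perm (Fin (n + 1))) (Conf n) where
  smul w z := ⟨fun i => z.1 (w⁻¹ i), z.2.1.comp (w⁻¹).injective,
    by rw [Equiv.sum_comp w⁻¹ z.1]; exact z.2.2⟩
  one_smul _ := rfl
  mul_smul _ _ _ := rfl

@[simp] theorem perm_smul_apply (w : Equiv.Perm (Fin (n + 1))) (z : Conf n) (i : Fin (n + 1)) :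
    (w • z).1 i = z.1 (w⁻¹ i) := rfl

theorem continuous_perm_smul (w : Equiv.Perm (Fin (n + 1))) :
    Continuous fun z : Conf n => w • z := by
  refine Continuous.subtype_mk (continuous_pi fun i => ?_) _
  exact (continuous_apply (w⁻¹ i)).comp continuous_subtype_val

/-- The monic polynomial with the given roots. -/
noncomputable def rootPoly (z : Fin (n + 1) → ℂ) : ℂ[X] := ∏ j, (X - C (z j))

theorem rootPoly_monic (z : Fin (n + 1) → ℂ) : (rootPoly z).Monic :=
  monic_prod_X_sub_C _ _

theorem rootPoly_natDegree (z : Fin (n + 1) → ℂ) : (rootPoly z).natDegree = n + 1 := by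
  simp [rootPoly]

theorem rootPoly_coeff_pred (z : Fin (n + 1) → ℂ) : (rootPoly z).coeff n = -∑ i, z i := by
  have := Polynomial.prod_X_sub_C_coeff_card_pred Finset.univ z (by simp)
  simpa [rootPoly] using this

theorem eval_rootPoly_eq_zero {z : Fin (n + 1) → ℂ} {y : ℂ} :
    (rootPoly z).eval y = 0 ↔ y ∈ Set.range z := by
  rw [rootPoly, eval_prod, Finset.prod_eq_zero_iff]
  simp [sub_eq_zero, eq_comm]

theorem continuous_coeff_prod_X_sub_C {ι : Type*} (s : Finset ι) (k : ℕ) :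
    Continuous fun z : ι → ℂ => (∏ j ∈ s, (X - C (z j))).coeff k := by
  classical
  induction s using Finset.induction_on generalizing k with
  | empty => simpa using continuous_const
  | insert a s ha ih =>
    simp only [Finset.prod_insert ha, sub_mul, coeff_sub, coeff_C_mul]
    refine Continuous.sub ?_ ((continuous_apply a).mul (ih k))
    cases k with
    | zero => simpa using continuous_const
    | succ k => simpa using ih k

theorem unfPoly_coeff_of_lt (u : Fin n → ℂ) (i : Fin n) : (unfPoly n u).coeff i = u i := by
  have h : (i : ℕ) ≠ n + 1 := by omega
  simp [unfPoly, coeff_X_pow, h, Fin.val_inj]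

theorem natDegree_sum_lt (u : Fin n → ℂ) :
    (∑ i : Fin n, C (u i) * X ^ (i : ℕ)).degree < ((n + 1 : ℕ) : WithBot ℕ) := by
  refine (degree_sum_le _ _).trans_lt ?_
  rw [Finset.sup_lt_iff (WithBot.bot_lt_coe _)]
  intro i _
  refine (degree_C_mul_X_pow_le _ _).trans_lt ?_
  exact_mod_cast Nat.lt_succ_of_lt i.2

theorem unfPoly_monic (u : Fin n → ℂ) : (unfPoly n u).Monic :=
  monic_X_pow_add (natDegree_sum_lt u)

theorem unfPoly_natDegree (u : Fin n → ℂ) : (unfPoly n u).natDegree = n + 1 := by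
  refine natDegree_eq_of_degree_eq_some ?_
  rw [unfPoly, degree_add_eq_left_of_degree_lt, degree_X_pow]
  rw [degree_X_pow]
  exact natDegree_sum_lt u

theorem unfPoly_coeff_pred (u : Fin n → ℂ) : (unfPoly n u).coeff n = 0 := by
  have h (x : Fin n) : n ≠ x := by omega
  simp [unfPoly, coeff_X_pow, h]

/-- A monic polynomial of degree `n + 1` without term of degree `n` is determined by its
coefficients of degree less than `n`. -/
theorem unfPoly_eq_of_coeff {u : Fin n → ℂ} {P : ℂ[X]} (hm : P.Monic) (hd : P.natDegree = n + 1)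
    (hn : P.coeff n = 0) (hu : ∀ i : Fin n, P.coeff i = u i) : unfPoly n u = P := by
  ext k
  rcases Nat.lt_trichotomy k n with h | h | h
  · rw [← hu ⟨k, h⟩ |>.trans (unfPoly_coeff_of_lt u ⟨k, h⟩).symm |>.symm]
  · rw [h, hn, unfPoly_coeff_pred]
  · rcases Nat.eq_or_lt_of_le (Nat.succ_le_of_lt h) with h | h
    · have h₁ := hm.coeff_natDegree
      have h₂ := (unfPoly_monic u).coeff_natDegree
      rw [hd] at h₁
      rw [unfPoly_natDegree] at h₂
      rw [← h]
      exact h₂.trans h₁.symm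
    · rw [coeff_eq_zero_of_natDegree_lt, coeff_eq_zero_of_natDegree_lt]
      · omega
      · rw [unfPoly_natDegree]; omega

theorem notMem_Discr_iff_separable (u : Fin n → ℂ) : u ∉ Discr n ↔ (unfPoly n u).Separable := by
  rw [Separable, isCoprime_iff_aeval_ne_zero_of_isAlgClosed ℂ ℂ]
  simp only [Discr, Set.mem_ofPred_eq, not_exists, not_and_or, coe_aeval_eq_eval, ne_eq]

theorem unfPoly_coeff_rootPoly {z : Fin (n + 1) → ℂ} (hz : ∑ i, z i = 0) :
    unfPoly n (fun i => (rootPoly z).coeff i) = rootPoly z :=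
  unfPoly_eq_of_coeff (rootPoly_monic z) (rootPoly_natDegree z)
    (by rw [rootPoly_coeff_pred, hz, neg_zero]) fun _ => rfl

theorem rootPoly_separable {z : Fin (n + 1) → ℂ} :
    (rootPoly z).Separable ↔ Function.Injective z :=
  separable_prod_X_sub_C_iff

/-- The map sending an ordered configuration to the unordered one, encoded by the coefficients of
the polynomial having these points as its roots. -/
noncomputable def toCoeff (z : Conf n) : DiscrCompl n :=
  ⟨fun i => (rootPoly z.1).coeff i, by
    rw [notMem_Discr_iff_separable, unfPoly_coeff_rootPoly z.2.2, rootPoly_separable]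
    exact z.2.1⟩

theorem unfPoly_toCoeff (z : Conf n) : unfPoly n (toCoeff z).1 = rootPoly z.1 :=
  unfPoly_coeff_rootPoly z.2.2

theorem continuous_toCoeff : Continuous (toCoeff : Conf n → DiscrCompl n) :=
  continuous_induced_rng.mpr (continuous_pi fun i =>
    (continuous_coeff_prod_X_sub_C Finset.univ i).comp continuous_subtype_val)

theorem exists_rootPoly_eq {P : ℂ[X]} (hm : P.Monic) (hd : P.natDegree = n + 1) :
    ∃ z : Fin (n + 1) → ℂ, rootPoly z = P := by
  have hs : P.Splits := IsAlgClosed.splits P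
  have hc : P.roots.toList.length = n + 1 := by
    rw [Multiset.length_toList, ← hd, hs.natDegree_eq_card_roots]
  have h₁ : (P.roots.toList.map fun a => X - C a).prod = P := by
    rw [← Multiset.prod_coe, ← Multiset.map_coe, Multiset.coe_toList]
    exact (hs.eq_prod_roots_of_monic hm).symm
  revert hc h₁
  generalize P.roots.toList = l
  intro hc h₁
  refine ⟨fun i => l.get (i.cast hc.symm), ?_⟩
  rw [← h₁, ← List.ofFn_getElem_eq_map, List.prod_ofFn]
  exact Fintype.prod_equiv (finCongr hc.symm) _ _ fun i => by simp

theorem toCoeff_surjective : Function.Surjective (toCoeff : Conf n → DiscrCompl n) := by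
  intro u
  obtain ⟨z, hz⟩ := exists_rootPoly_eq (unfPoly_monic u.1) (unfPoly_natDegree u.1)
  have h₀ : ∑ i, z i = 0 := by
    rw [← neg_eq_zero, ← rootPoly_coeff_pred, hz, unfPoly_coeff_pred]
  refine ⟨⟨z, ?_, h₀⟩, ?_⟩
  · rw [← rootPoly_separable, hz, ← notMem_Discr_iff_separable]
    exact u.2
  · ext i
    change (rootPoly z).coeff i = _
    rw [hz, unfPoly_coeff_of_lt]

theorem toCoeff_smul (w : Equiv.Perm (Fin (n + 1))) (z : Conf n) :
    toCoeff (w • z) = toCoeff z := by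
  refine Subtype.ext (funext fun i => ?_)
  change (rootPoly (w • z).1).coeff i = (rootPoly z.1).coeff i
  congr 1
  exact Equiv.prod_comp w⁻¹ fun j => X - C (z.1 j)

theorem toCoeff_eq_iff {z z' : Conf n} :
    toCoeff z = toCoeff z' ↔ ∃ w : Equiv.Perm (Fin (n + 1)), w • z' = z := by
  refine ⟨fun h => ?_, fun ⟨w, hw⟩ => hw ▸ toCoeff_smul w z'⟩
  have hr : Set.range z'.1 = Set.range z.1 := by
    ext y
    rw [← eval_rootPoly_eq_zero, ← eval_rootPoly_eq_zero, ← unfPoly_toCoeff, ← unfPoly_toCoeff, h]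
  let e : Equiv.Perm (Fin (n + 1)) := (Equiv.ofInjective _ z'.2.1).trans
    ((Equiv.setCongr hr).trans (Equiv.ofInjective _ z.2.1).symm)
  refine ⟨e, Subtype.ext (funext fun i => ?_)⟩
  obtain ⟨j, rfl⟩ := e.surjective i
  have : z.1 (e j) = z'.1 j := by
    simp [e, Equiv.apply_ofInjective_symm]
  simp [this]

theorem norm_root_le {u : Fin n → ℂ} {y : ℂ} (hy : (unfPoly n u).eval y = 0) :
    ‖y‖ ≤ 1 + n * ‖u‖ := by
  by_contra! hlt
  have h₁ : 1 ≤ ‖y‖ := by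
    have : 0 ≤ n * ‖u‖ := by positivity
    linarith
  have h₀ : y ^ (n + 1) = -∑ i : Fin n, u i * y ^ (i : ℕ) := by
    rw [eq_neg_iff_add_eq_zero, ← hy]
    simp [unfPoly, eval_finsetSum]
  have h₂ : ‖y‖ ^ (n + 1) ≤ n * ‖u‖ * ‖y‖ ^ n := by
    rw [← norm_pow, h₀, norm_neg]
    refine (norm_sum_le _ _).trans ?_
    calc ∑ i : Fin n, ‖u i * y ^ (i : ℕ)‖ ≤ ∑ _i : Fin n, ‖u‖ * ‖y‖ ^ n := by
          refine Finset.sum_le_sum fun i _ => ?_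
          rw [norm_mul, norm_pow]
          exact mul_le_mul (norm_le_pi_norm u i) (pow_le_pow_right₀ h₁ i.2.le) (by positivity)
            (by positivity)
      _ = n * ‖u‖ * ‖y‖ ^ n := by simp [mul_assoc]
  have h₃ : 0 < ‖y‖ ^ n := by positivity
  rw [pow_succ, mul_comm] at h₂
  have := le_of_mul_le_mul_right h₂ h₃
  linarith

theorem isProperMap_toCoeff : IsProperMap (toCoeff : Conf n → DiscrCompl n) := by
  rw [isProperMap_iff_ultrafilter]
  refine ⟨continuous_toCoeff, fun 𝒰 u hu => ?_⟩
  have hu' : Filter.Tendsto (fun z : Conf n => (toCoeff z).1) 𝒰 (nhds u.1) :=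
    (continuous_subtype_val.tendsto u).comp hu
  have hb : ∀ᶠ z : Conf n in 𝒰, z.1 ∈ Metric.closedBall (0 : Fin (n + 1) → ℂ)
      (1 + n * (‖u.1‖ + 1)) := by
    filter_upwards [hu'.norm.eventually_lt_const (lt_add_one ‖u.1‖)] with z hz
    rw [mem_closedBall_zero_iff, pi_norm_le_iff_of_nonneg (by positivity)]
    intro i
    have := norm_root_le (u := (toCoeff z).1) (y := z.1 i)
      (by rw [unfPoly_toCoeff]; exact eval_rootPoly_eq_zero.mpr ⟨i, rfl⟩)
    refine this.trans ?_
    gcongr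
  obtain ⟨z, -, hz⟩ := (isCompact_closedBall (0 : Fin (n + 1) → ℂ)
    (1 + n * (‖u.1‖ + 1))).ultrafilter_le_nhds (𝒰.map Subtype.val)
      (Filter.le_principal_iff.mpr (Filter.mem_map.mpr hb))
  have hz' : Filter.Tendsto (Subtype.val : Conf n → _) 𝒰 (nhds z) := hz
  have hsum : ∑ i, z i = 0 := by
    have hc : Continuous fun z : Fin (n + 1) → ℂ => ∑ i, z i := by fun_prop
    refine tendsto_nhds_unique ((hc.tendsto z).comp hz') ?_
    exact tendsto_const_nhds.congr fun z : Conf n => z.2.2.symm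
  have hcoeff : ∀ i : Fin n, (rootPoly z).coeff i = u.1 i := fun i => by
    have hc := (continuous_coeff_prod_X_sub_C (Finset.univ : Finset (Fin (n + 1))) i)
    exact tendsto_nhds_unique ((hc.tendsto z).comp hz') ((tendsto_pi_nhds.mp hu') i)
  have hP : unfPoly n u.1 = rootPoly z := by
    rw [← unfPoly_coeff_rootPoly hsum]
    congr 1
    exact funext fun i => (hcoeff i).symm
  have hinj : Function.Injective z := by
    rw [← rootPoly_separable, ← hP, ← notMem_Discr_iff_separable]
    exact u.2
  refine ⟨⟨z, ⟨hinj, hsum⟩⟩, Subtype.ext (funext hcoeff), ?_⟩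
  exact (Topology.IsInducing.subtypeVal.tendsto_nhds_iff (f := id)).mpr hz'

theorem isQuotientMap_toCoeff : Topology.IsQuotientMap (toCoeff : Conf n → DiscrCompl n) :=
  isProperMap_toCoeff.isClosedMap.isQuotientMap continuous_toCoeff toCoeff_surjective

/-- The lexicographic order on complex numbers, by real part and then by imaginary part. -/
def lexKey (z : ℂ) : ℝ ×ₗ ℝ := toLex (z.re, z.im)

theorem lexKey_lt_iff {z w : ℂ} :
    lexKey z < lexKey w ↔ z.re < w.re ∨ z.re = w.re ∧ z.im < w.im :=
  Prod.Lex.toLex_lt_toLex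

theorem lexKey_injective : Function.Injective lexKey := fun z w h => by
  have h' := toLex.injective h
  exact Complex.ext (congrArg Prod.fst h') (congrArg Prod.snd h')

/-- The complex numbers that are lexicographically positive. -/
def lexPos : Set ℂ := {d | 0 < d.re ∨ d.re = 0 ∧ 0 < d.im}

/-- The complex numbers with positive real part. -/
def rePos : Set ℂ := {d | 0 < d.re}

/-- The complex numbers with positive imaginary part. -/
def imPos : Set ℂ := {d | 0 < d.im}

theorem sub_mem_lexPos {z w : ℂ} : w - z ∈ lexPos ↔ lexKey z < lexKey w := by
  rw [lexKey_lt_iff, lexPos, Set.mem_ofPred_eq, Complex.sub_re, Complex.sub_im, sub_pos, sub_pos,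
    sub_eq_zero, eq_comm (a := w.re)]

theorem sub_mem_rePos {z w : ℂ} : w - z ∈ rePos ↔ z.re < w.re := by
  rw [rePos, Set.mem_ofPred_eq, Complex.sub_re, sub_pos]

theorem sub_mem_imPos {z w : ℂ} : w - z ∈ imPos ↔ z.im < w.im := by
  rw [imPos, Set.mem_ofPred_eq, Complex.sub_im, sub_pos]

theorem convex_rePos : Convex ℝ rePos := convex_halfSpace_re_gt 0

theorem convex_imPos : Convex ℝ imPos := convex_halfSpace_im_gt 0

theorem convex_lexPos : Convex ℝ lexPos := by
  rw [convex_iff_forall_pos]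
  rintro x (hx | hx) y (hy | hy) a b ha hb -
  · left; simp; positivity
  · left; simp [hy.1]; positivity
  · left; simp [hx.1]; positivity
  · right
    have := hx.2
    have := hy.2
    refine ⟨by simp [hx.1, hy.1], ?_⟩
    simp; positivity

theorem zero_notMem_lexPos : (0 : ℂ) ∉ lexPos := by simp [lexPos]

theorem zero_notMem_imPos : (0 : ℂ) ∉ imPos := by simp [imPos]

theorem convex_setOf_imp {P : Prop} {K : Set ℂ} (hK : Convex ℝ K) : Convex ℝ {d | P → d ∈ K} := by
  by_cases h : P
  · simpa [h] using hK
  · simpa [h] using convex_univ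

/-- The tuples with sum zero all of whose differences lie in prescribed sets. -/
def coneSet (K : Fin (n + 1) → Fin (n + 1) → Set ℂ) : Set (Fin (n + 1) → ℂ) :=
  {z | ∑ i, z i = 0 ∧ ∀ j k, z k - z j ∈ K j k}

theorem convex_coneSet {K : Fin (n + 1) → Fin (n + 1) → Set ℂ} (hK : ∀ j k, Convex ℝ (K j k)) :
    Convex ℝ (coneSet K) := by
  rintro x ⟨hx₀, hx⟩ y ⟨hy₀, hy⟩ a b ha hb hab
  refine ⟨?_, fun j k => ?_⟩
  · simp only [Pi.add_apply, Pi.smul_apply, Finset.sum_add_distrib, ← Finset.smul_sum, hx₀, hy₀,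
      smul_zero, add_zero]
  · convert hK j k (hx j k) (hy j k) ha hb hab using 1
    simp only [Pi.add_apply, Pi.smul_apply, smul_sub]
    abel

theorem coneSet_subset_confSet {K : Fin (n + 1) → Fin (n + 1) → Set ℂ}
    (hK : ∀ j k, j ≠ k → (0 : ℂ) ∉ K j k ∨ (0 : ℂ) ∉ K k j) : coneSet K ⊆ confSet n := by
  rintro z ⟨hz₀, hz⟩
  refine ⟨fun j k hjk => ?_, hz₀⟩
  by_contra hne
  have h₁ := hz j k
  have h₂ := hz k j
  rw [hjk, sub_self] at h₁ h₂
  exact (hK j k hne).elim (· h₁) (· h₂)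

theorem isOpen_setOf_imp {α : Type*} [TopologicalSpace α] {P : Prop} {s : Set α} (hs : IsOpen s) :
    IsOpen {x | P → x ∈ s} := by
  by_cases h : P
  · simpa [h] using hs
  · simp [h]

/-- The permutation sorting the points of a configuration lexicographically. -/
noncomputable def ordPerm (z : Conf n) : Equiv.Perm (Fin (n + 1)) := Tuple.sort (lexKey ∘ z.1)

theorem strictMono_ordPerm (z : Conf n) : StrictMono (lexKey ∘ z.1 ∘ ordPerm z) :=
  (Tuple.monotone_sort (lexKey ∘ z.1)).strictMono_of_injective
    (lexKey_injective.comp (z.2.1.comp (ordPerm z).injective))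

theorem ordPerm_eq {z : Conf n} {w : Equiv.Perm (Fin (n + 1))}
    (h : StrictMono (lexKey ∘ z.1 ∘ w)) : ordPerm z = w := by
  have h₁ := (Tuple.comp_sort_eq_comp_iff_monotone (f := lexKey ∘ z.1) (σ := w)).mpr h.monotone
  ext i : 1
  exact ((lexKey_injective.comp z.2.1) (congrFun h₁ i)).symm

theorem ordPerm_inv_lt_iff (z : Conf n) (j k : Fin (n + 1)) :
    (ordPerm z)⁻¹ j < (ordPerm z)⁻¹ k ↔ lexKey (z.1 j) < lexKey (z.1 k) := by
  rw [← (strictMono_ordPerm z).lt_iff_lt]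
  simp

theorem ordPerm_eq_of_forall {z : Conf n} {w : Equiv.Perm (Fin (n + 1))}
    (h : ∀ j k, w⁻¹ j < w⁻¹ k → lexKey (z.1 j) < lexKey (z.1 k)) : ordPerm z = w :=
  ordPerm_eq fun a b hab => h _ _ (by simpa using hab)

theorem ordPerm_smul (w : Equiv.Perm (Fin (n + 1))) (z : Conf n) :
    ordPerm (w • z) = w * ordPerm z := by
  refine ordPerm_eq ?_
  convert strictMono_ordPerm z using 1
  ext i : 1
  simp

/-- The relative position of two configurations. -/
noncomputable def relPerm (p x : Conf n) : Equiv.Perm (Fin (n + 1)) := (ordPerm p)⁻¹ * ordPerm x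

@[simp] theorem relPerm_smul (w : Equiv.Perm (Fin (n + 1))) (p x : Conf n) :
    relPerm (w • p) (w • x) = relPerm p x := by
  simp [relPerm, ordPerm_smul, mul_assoc]

@[simp] theorem relPerm_self (p : Conf n) : relPerm p p = 1 := by simp [relPerm]

/-- The configurations keeping the strict order of the real parts of `p`, and the strict order of
the imaginary parts of points of `p` with the same real part. -/
def starSet (p : Conf n) : Set (Fin (n + 1) → ℂ) :=
  coneSet fun j k => {d | (p.1 j).re < (p.1 k).re → d ∈ rePos} ∩
    {d | (p.1 j).re = (p.1 k).re ∧ (p.1 j).im < (p.1 k).im → d ∈ imPos}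

theorem convex_starSet (p : Conf n) : Convex ℝ (starSet p) :=
  convex_coneSet fun _ _ => (convex_setOf_imp convex_rePos).inter (convex_setOf_imp convex_imPos)

theorem mem_starSet {p : Conf n} {x : Fin (n + 1) → ℂ} (hx : ∑ i, x i = 0) :
    x ∈ starSet p ↔ ∀ j k, ((p.1 j).re < (p.1 k).re → (x j).re < (x k).re) ∧
      ((p.1 j).re = (p.1 k).re ∧ (p.1 j).im < (p.1 k).im → (x j).im < (x k).im) := by
  simp only [starSet, coneSet, Set.mem_ofPred_eq, hx, true_and, Set.mem_inter_iff, sub_mem_rePos,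
    sub_mem_imPos]

theorem starSet_subset_confSet (p : Conf n) : starSet p ⊆ confSet n := by
  refine coneSet_subset_confSet fun j k hjk => ?_
  rcases lt_trichotomy (p.1 j).re (p.1 k).re with h | h | h
  · left; simp [h, rePos]
  · rcases lt_trichotomy (p.1 j).im (p.1 k).im with h' | h' | h'
    · left; simp [h, h', imPos]
    · exact absurd (p.2.1 (Complex.ext h h')) hjk
    · right; simp [h, h', imPos]
  · right; simp [h, rePos]

/-- The star of a configuration, as a set of configurations. -/
def star (p : Conf n) : Set (Conf n) := {x | x.1 ∈ starSet p}

theorem mem_star {p x : Conf n} :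
    x ∈ star p ↔ ∀ j k, ((p.1 j).re < (p.1 k).re → (x.1 j).re < (x.1 k).re) ∧
      ((p.1 j).re = (p.1 k).re ∧ (p.1 j).im < (p.1 k).im → (x.1 j).im < (x.1 k).im) :=
  mem_starSet x.2.2

theorem self_mem_star (p : Conf n) : p ∈ star p :=
  mem_star.mpr fun _ _ => ⟨id, And.right⟩

theorem smul_mem_star {w : Equiv.Perm (Fin (n + 1))} {p x : Conf n} (h : x ∈ star p) :
    w • x ∈ star (w • p) :=
  mem_star.mpr fun j k => mem_star.mp h (w⁻¹ j) (w⁻¹ k)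

theorem isOpen_star (p : Conf n) : IsOpen (star p) := by
  have h : star p = ⋂ j, ⋂ k, ({x : Conf n | (p.1 j).re < (p.1 k).re → (x.1 j).re < (x.1 k).re} ∩
      {x : Conf n | (p.1 j).re = (p.1 k).re ∧ (p.1 j).im < (p.1 k).im →
        (x.1 j).im < (x.1 k).im}) := by
    ext x
    simp only [mem_star, Set.mem_iInter, Set.mem_inter_iff, Set.mem_ofPred_eq]
  have hc (j : Fin (n + 1)) : Continuous fun x : Conf n => x.1 j :=
    (continuous_apply j).comp continuous_subtype_val
  rw [h]
  refine isOpen_iInter_of_finite fun j => isOpen_iInter_of_finite fun k => IsOpen.inter ?_ ?_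
  · exact isOpen_setOf_imp (isOpen_lt (Complex.continuous_re.comp (hc j))
      (Complex.continuous_re.comp (hc k)))
  · exact isOpen_setOf_imp (isOpen_lt (Complex.continuous_im.comp (hc j))
      (Complex.continuous_im.comp (hc k)))

theorem star_mem_nhds (p : Conf n) : star p ∈ nhds p :=
  (isOpen_star p).mem_nhds (self_mem_star p)

/-- The braid carrying the order of `p` to that of `x`, for `x` in the star of `p`. -/
noncomputable def braidStep (p x : Conf n) : Braid n := braidLift (relPerm p x)

@[simp] theorem braidStep_self (p : Conf n) : braidStep p p = 1 := by simp [braidStep]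

@[simp] theorem braidStep_smul (w : Equiv.Perm (Fin (n + 1))) (p x : Conf n) :
    braidStep (w • p) (w • x) = braidStep p x := by
  simp [braidStep]

theorem relPerm_mul (p q x : Conf n) : relPerm p q * relPerm q x = relPerm p x := by
  simp [relPerm, mul_assoc]

theorem braidStep_mul {p q x : Conf n} (hq : q ∈ star p) (hx : x ∈ star p) (hqx : x ∈ star q) :
    braidStep p q * braidStep q x = braidStep p x := by
  rw [braidStep, braidStep, braidStep, ← relPerm_mul p q x]
  refine (braidLift_mul fun a b hab hv => ?_).symm
  obtain ⟨j, rfl⟩ := (ordPerm x)⁻¹.surjective a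
  obtain ⟨k, rfl⟩ := (ordPerm x)⁻¹.surjective b
  have hi (w : Equiv.Perm (Fin (n + 1))) (i : Fin (n + 1)) : w (w⁻¹ i) = i := w.apply_symm_apply i
  simp only [relPerm, Equiv.Perm.mul_apply, hi] at hv ⊢
  rw [ordPerm_inv_lt_iff] at hab hv ⊢
  have hjk : j ≠ k := by rintro rfl; exact lt_irrefl _ hab
  by_contra hp
  have hp' := lt_of_le_of_ne (not_lt.mp hp) (fun h => hjk (p.2.1 (lexKey_injective h)))
  rw [lexKey_lt_iff] at hp' hab hv
  have h₁ := mem_star.mp hq j k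
  have h₂ := mem_star.mp hx j k
  have h₃ := mem_star.mp hqx k j
  rcases hp' with h | h
  · have := h₁.1 h
    rcases hv with hv | hv <;> linarith
  · have h₄ := h₁.2 h
    have h₅ := h₂.2 h
    rcases hv with hv | hv
    · have := h₃.1 hv
      rcases hab with hab | hab <;> linarith
    · linarith [hv.2]

/-- The covering space of `Conf n` whose sheets over a star are glued by `braidStep`. -/
@[ext] structure BraidCover (n : ℕ) where
  /-- The sheet. -/
  braid : Braid n
  /-- The underlying configuration. -/
  conf : Conf n

instance : TopologicalSpace (BraidCover n) where
  IsOpen U := ∀ e ∈ U, ∀ᶠ x in nhds e.conf, (⟨e.braid * braidStep e.conf x, x⟩ : BraidCover n) ∈ U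
  isOpen_univ := by simp
  isOpen_inter U V hU hV e he := by
    filter_upwards [hU e he.1, hV e he.2] with x h₁ h₂ using ⟨h₁, h₂⟩
  isOpen_sUnion S hS e he := by
    obtain ⟨U, hU, heU⟩ := he
    filter_upwards [hS U hU e heU] with x hx using ⟨U, hU, hx⟩

theorem continuous_braidCover_conf : Continuous (BraidCover.conf : BraidCover n → Conf n) :=
  ⟨fun _ hU _ he => hU.mem_nhds he⟩

theorem isOpenMap_braidCover_conf : IsOpenMap (BraidCover.conf : BraidCover n → Conf n) := by
  intro U hU
  rw [isOpen_iff_mem_nhds]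
  rintro _ ⟨e, he, rfl⟩
  filter_upwards [hU e he] with x hx using ⟨_, hx, rfl⟩

theorem surjective_braidCover_conf :
    Function.Surjective (BraidCover.conf : BraidCover n → Conf n) :=
  fun x => ⟨⟨1, x⟩, rfl⟩

theorem isOpen_sheet (g : Braid n) {p : Conf n} {V : Set (Conf n)} (hV : IsOpen V)
    (hVp : V ⊆ star p) :
    IsOpen {e : BraidCover n | e.conf ∈ V ∧ e.braid = g * braidStep p e.conf} := by
  rintro e ⟨hq, he⟩
  filter_upwards [hV.mem_nhds hq, star_mem_nhds e.conf] with x hx hqx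
  refine ⟨hx, ?_⟩
  simp only [he, mul_assoc]
  rw [braidStep_mul (hVp hq) (hVp hx) hqx]

instance : MulAction (Braid n × Equiv.Perm (Fin (n + 1))) (BraidCover n) where
  smul g e := ⟨g.1 * e.braid, g.2 • e.conf⟩
  one_smul _ := BraidCover.ext (one_mul _) (one_smul _ _)
  mul_smul _ _ _ := BraidCover.ext (mul_assoc _ _ _) (mul_smul _ _ _)

@[simp] theorem braid_smul (g : Braid n × Equiv.Perm (Fin (n + 1))) (e : BraidCover n) :
    (g • e).braid = g.1 * e.braid := rfl

@[simp] theorem conf_smul (g : Braid n × Equiv.Perm (Fin (n + 1))) (e : BraidCover n) :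
    (g • e).conf = g.2 • e.conf := rfl

theorem continuous_braidCover_smul (g : Braid n × Equiv.Perm (Fin (n + 1))) :
    Continuous fun e : BraidCover n => g • e := by
  refine ⟨fun U hU e he => ?_⟩
  filter_upwards [((continuous_perm_smul g.2).tendsto e.conf).eventually (hU _ he)] with x hx
  have h : (⟨(g • e).braid * braidStep (g • e).conf (g.2 • x), g.2 • x⟩ : BraidCover n) =
      g • ⟨e.braid * braidStep e.conf x, x⟩ := by
    ext1
    · simp [mul_assoc]
    · rfl
  rwa [h] at hx

theorem perm_smul_ne {w : Equiv.Perm (Fin (n + 1))} (hw : w ≠ 1) (z : Conf n) : w • z ≠ z := by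
  intro h
  refine hw (Equiv.ext fun i => ?_)
  have := congrFun (congrArg Subtype.val h) (w i)
  rw [perm_smul_apply] at this
  have h₂ : w⁻¹ (w i) = w i := z.2.1 this
  exact h₂.symm.trans (w.symm_apply_apply i)

theorem exists_nhds_perm_smul_disjoint (z : Conf n) : ∃ V ∈ nhds z,
    ∀ w : Equiv.Perm (Fin (n + 1)), ∀ x ∈ V, w • x ∈ V → w = 1 := by
  have h (w : Equiv.Perm (Fin (n + 1))) : ∃ V ∈ nhds z, ∀ x ∈ V, w • x ∈ V → w = 1 := by
    by_cases hw : w = 1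
    · exact ⟨Set.univ, Filter.univ_mem, fun _ _ _ => hw⟩
    obtain ⟨A, B, hA, hB, hzA, hzB, hAB⟩ := t2_separation (perm_smul_ne hw z)
    refine ⟨B ∩ (fun x => w • x) ⁻¹' A, Filter.inter_mem (hB.mem_nhds hzB)
      ((hA.preimage (continuous_perm_smul w)).mem_nhds hzA), fun x hx hwx => ?_⟩
    exact absurd hwx.1 (Set.disjoint_left.mp hAB hx.2)
  choose V hV h using h
  exact ⟨⋂ w, V w, Filter.iInter_mem.mpr hV, fun w x hx hwx =>
    h w x (Set.mem_iInter.mp hx w) (Set.mem_iInter.mp hwx w)⟩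

theorem isQuotientCoveringMap_toCoeff_conf :
    IsQuotientCoveringMap (fun e : BraidCover n => toCoeff e.conf)
      (Braid n × Equiv.Perm (Fin (n + 1))) where
  toIsQuotientMap := isQuotientMap_toCoeff.comp (isOpenMap_braidCover_conf.isQuotientMap
    continuous_braidCover_conf surjective_braidCover_conf)
  continuous_const_smul := continuous_braidCover_smul
  apply_eq_iff_mem_orbit {e₁ e₂} := by
    rw [toCoeff_eq_iff]
    constructor
    · rintro ⟨w, hw⟩
      exact ⟨(e₁.braid * e₂.braid⁻¹, w), BraidCover.ext (by simp) hw⟩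
    · rintro ⟨g, rfl⟩
      exact ⟨g.2, rfl⟩
  disjoint e := by
    obtain ⟨V, hV, h⟩ := exists_nhds_perm_smul_disjoint e.conf
    obtain ⟨W, hWV, hW, heW⟩ := mem_nhds_iff.mp (Filter.inter_mem hV (star_mem_nhds e.conf))
    refine ⟨_, (isOpen_sheet e.braid hW (hWV.trans Set.inter_subset_right)).mem_nhds
      ⟨heW, by simp⟩, ?_⟩
    rintro g ⟨_, ⟨x, hx, rfl⟩, hgx⟩
    have h₁ : g.2 = 1 := h _ _ (hWV hx.1).1 (hWV hgx.1).1
    have h₂ := hgx.2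
    simp only [braid_smul, conf_smul, h₁, one_smul, ← hx.2] at h₂
    exact Prod.ext (mul_eq_right.mp h₂) h₁

theorem continuous_braidCover_mk {T : Type*} [TopologicalSpace T] {φ : T → Braid n}
    {γ : T → Conf n} (hγ : Continuous γ)
    (h : ∀ t, ∀ᶠ s in nhds t, φ s = φ t * braidStep (γ t) (γ s)) :
    Continuous fun t => (⟨φ t, γ t⟩ : BraidCover n) := by
  refine ⟨fun U hU => ?_⟩
  rw [isOpen_iff_mem_nhds]
  intro t ht
  filter_upwards [h t, (hγ.tendsto t).eventually (hU _ ht)] with s hs hsU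
  rwa [Set.mem_preimage, hs]

theorem continuous_braidCover_mk_of_ordPerm_eq {T : Type*} [TopologicalSpace T] (g : Braid n)
    {γ : T → Conf n} (hγ : Continuous γ) (h : ∀ s t, ordPerm (γ s) = ordPerm (γ t)) :
    Continuous fun t => (⟨g, γ t⟩ : BraidCover n) :=
  continuous_braidCover_mk hγ fun t => .of_forall fun s => by
    simp [braidStep, relPerm, h s t]

theorem continuous_braidCover_mk_of_mem_star {T : Type*} [TopologicalSpace T] (g : Braid n)
    {γ : T → Conf n} (hγ : Continuous γ) {p : Conf n} (h : ∀ t, γ t ∈ star p) :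
    Continuous fun t => (⟨g * braidStep p (γ t), γ t⟩ : BraidCover n) :=
  continuous_braidCover_mk hγ fun t => by
    filter_upwards [(hγ.tendsto t).eventually (star_mem_nhds (γ t))] with s hs
    rw [mul_assoc, braidStep_mul (h t) (h s) hs]

/-- The coordinates of `n + 1` equidistant real points with sum zero. -/
noncomputable def basePt (k : Fin (n + 1)) : ℝ := (k : ℕ) - n / 2

theorem basePt_strictMono : StrictMono (basePt : Fin (n + 1) → ℝ) := fun j k h => by
  have : ((j : ℕ) : ℝ) < (k : ℕ) := by exact_mod_cast h
  simpa [basePt] using this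

theorem basePt_lt_iff {j k : Fin (n + 1)} : basePt j < basePt k ↔ j < k :=
  basePt_strictMono.lt_iff_lt

theorem sum_basePt : ∑ k : Fin (n + 1), basePt k = 0 := by
  have h : (∑ k : Fin (n + 1), ((k : ℕ) : ℝ)) * 2 = (n + 1) * n := by
    rw [Fin.sum_univ_eq_sum_range (fun k => (k : ℝ))]
    have := Finset.sum_range_id_mul_two (n + 1)
    rw [Nat.add_sub_cancel] at this
    have h := congrArg (Nat.cast (R := ℝ)) this
    push_cast at h
    exact h
  simp only [basePt, Finset.sum_sub_distrib, Finset.sum_const, Finset.card_univ, Fintype.card_fin,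
    nsmul_eq_mul]
  push_cast
  linarith

/-- The configuration with prescribed real parts and equidistant imaginary parts. -/
noncomputable def rowConf (f : Fin (n + 1) → ℝ) (hf : ∑ k, f k = 0) : Conf n :=
  ⟨fun k => ⟨f k, basePt k⟩,
    ⟨fun _ _ h => basePt_strictMono.injective (congrArg Complex.im h), by
      apply Complex.ext
      · simpa using hf
      · simpa using sum_basePt⟩⟩

@[simp] theorem rowConf_re (f : Fin (n + 1) → ℝ) (hf : ∑ k, f k = 0) (k : Fin (n + 1)) :
    ((rowConf f hf).1 k).re = f k := rfl

@[simp] theorem rowConf_im (f : Fin (n + 1) → ℝ) (hf : ∑ k, f k = 0) (k : Fin (n + 1)) :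
    ((rowConf f hf).1 k).im = basePt k := rfl

/-- The base configuration. -/
noncomputable def baseConf (n : ℕ) : Conf n :=
  ⟨fun k => (basePt k : ℂ), ⟨fun _ _ h => basePt_strictMono.injective (Complex.ofReal_injective h),
    by rw [← Complex.ofReal_sum, sum_basePt, Complex.ofReal_zero]⟩⟩

theorem ordPerm_baseConf : ordPerm (baseConf n) = 1 :=
  ordPerm_eq fun j k h => lexKey_lt_iff.mpr (.inl (by simpa [baseConf] using basePt_strictMono h))

/-- The tuples with sum zero whose lexicographic order is sorted by `w`. -/
def cellSet (w : Equiv.Perm (Fin (n + 1))) : Set (Fin (n + 1) → ℂ) :=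
  coneSet fun j k => {d | w⁻¹ j < w⁻¹ k → d ∈ lexPos}

theorem convex_cellSet (w : Equiv.Perm (Fin (n + 1))) : Convex ℝ (cellSet w) :=
  convex_coneSet fun _ _ => convex_setOf_imp convex_lexPos

theorem cellSet_subset_confSet (w : Equiv.Perm (Fin (n + 1))) : cellSet w ⊆ confSet n := by
  refine coneSet_subset_confSet fun j k hjk => ?_
  rcases lt_trichotomy (w⁻¹ j) (w⁻¹ k) with h | h | h
  · exact .inl fun h₀ => zero_notMem_lexPos (h₀ h)
  · exact absurd (w⁻¹.injective h) hjk
  · exact .inr fun h₀ => zero_notMem_lexPos (h₀ h)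

theorem mem_cellSet_iff {w : Equiv.Perm (Fin (n + 1))} {z : Conf n} :
    z.1 ∈ cellSet w ↔ ordPerm z = w := by
  simp only [cellSet, coneSet, Set.mem_ofPred_eq, z.2.2, true_and, sub_mem_lexPos]
  refine ⟨fun h => ordPerm_eq_of_forall h, ?_⟩
  rintro rfl j k h
  exact (ordPerm_inv_lt_iff z j k).mp h

/-- The straight path between two configurations. -/
noncomputable def segPath (x y : Conf n) {S : Set (Fin (n + 1) → ℂ)} (hS : Convex ℝ S)
    (hSc : S ⊆ confSet n) (hx : x.1 ∈ S) (hy : y.1 ∈ S) : Path x y where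
  toFun t := ⟨AffineMap.lineMap x.1 y.1 (t : ℝ), hSc (hS.lineMap_mem hx hy t.2)⟩
  continuous_toFun := Continuous.subtype_mk
    ((AffineMap.lineMap_continuous (R := ℝ)).comp continuous_subtype_val) _
  source' := Subtype.ext (by simp)
  target' := Subtype.ext (by simp)

theorem segPath_val (x y : Conf n) {S : Set (Fin (n + 1) → ℂ)} (hS : Convex ℝ S)
    (hSc : S ⊆ confSet n) (hx : x.1 ∈ S) (hy : y.1 ∈ S) (t : unitInterval) :
    (segPath x y hS hSc hx hy t).1 = AffineMap.lineMap x.1 y.1 (t : ℝ) := rfl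

theorem segPath_mem (x y : Conf n) {S T : Set (Fin (n + 1) → ℂ)} (hS : Convex ℝ S)
    (hSc : S ⊆ confSet n) (hx : x.1 ∈ S) (hy : y.1 ∈ S) (hT : Convex ℝ T) (hx' : x.1 ∈ T)
    (hy' : y.1 ∈ T) (t : unitInterval) : (segPath x y hS hSc hx hy t).1 ∈ T :=
  hT.lineMap_mem hx' hy' t.2

theorem homotopic_of_mem_convex {x y : Conf n} {γ γ' : Path x y} {S : Set (Fin (n + 1) → ℂ)}
    (hS : Convex ℝ S) (hSc : S ⊆ confSet n) (h : ∀ t, (γ t).1 ∈ S) (h' : ∀ t, (γ' t).1 ∈ S) :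
    γ.Homotopic γ' := by
  refine ⟨{
    toFun := fun st => ⟨AffineMap.lineMap (γ st.2).1 (γ' st.2).1 (st.1 : ℝ),
      hSc (hS.lineMap_mem (h _) (h' _) st.1.2)⟩
    continuous_toFun := ?_
    map_zero_left := fun t => Subtype.ext (by simp)
    map_one_left := fun t => Subtype.ext (by simp)
    prop' := ?_ }⟩
  · refine Continuous.subtype_mk ?_ _
    simp only [AffineMap.lineMap_apply_module]
    fun_prop
  · intro t s hs
    refine Subtype.ext ?_
    rcases hs with rfl | rfl <;> simp

theorem forall_trans_apply {X : Type*} [TopologicalSpace X] {x y z : X} {γ : Path x y}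
    {γ' : Path y z} {p : X → Prop} (h : ∀ t, p (γ t)) (h' : ∀ t, p (γ' t)) (t : unitInterval) :
    p (γ.trans γ' t) := by
  rw [Path.trans_apply]
  split_ifs
  exacts [h _, h' _]

/-- The arrow of the fundamental groupoid given by a path. -/
def pathArrow {X : Type*} [TopologicalSpace X] {x y : X} (γ : Path x y) :
    FundamentalGroupoid.mk x ⟶ FundamentalGroupoid.mk y :=
  Path.Homotopic.Quotient.mk γ

theorem pathArrow_trans {X : Type*} [TopologicalSpace X] {x y z : X} (γ : Path x y)
    (γ' : Path y z) : pathArrow (γ.trans γ') = pathArrow γ ≫ pathArrow γ' := rfl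

theorem pathArrow_refl {X : Type*} [TopologicalSpace X] (x : X) :
    pathArrow (Path.refl x) = 𝟙 _ := rfl

theorem pathArrow_eq_of_homotopic {X : Type*} [TopologicalSpace X] {x y : X} {γ γ' : Path x y}
    (h : γ.Homotopic γ') : pathArrow γ = pathArrow γ' := Path.Homotopic.Quotient.eq.mpr h

theorem pathArrow_conj_congr {X : Type*} [TopologicalSpace X] {o x y x' y' : X}
    {γ : Path x y} {γ' : Path x' y'} {c : Path o x} {c' : Path o x'} {d : Path o y} {d' : Path o y'}
    (hγ : ∀ t, γ t = γ' t) (hc : ∀ t, c t = c' t) (hd : ∀ t, d t = d' t) :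
    pathArrow c ≫ pathArrow γ ≫ inv (pathArrow d) =
      pathArrow c' ≫ pathArrow γ' ≫ inv (pathArrow d') := by
  obtain rfl : x = x' := by simpa using hγ 0
  obtain rfl : y = y' := by simpa using hγ 1
  obtain rfl : γ = γ' := Path.ext (funext hγ)
  obtain rfl : c = c' := Path.ext (funext hc)
  obtain rfl : d = d' := Path.ext (funext hd)
  rfl

theorem smul_baseConf_mem_cellSet (w : Equiv.Perm (Fin (n + 1))) :
    (w • baseConf n).1 ∈ cellSet w :=
  mem_cellSet_iff.mpr (by rw [ordPerm_smul, ordPerm_baseConf, mul_one])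

/-- The straight path to a configuration from the relabelled base configuration in its cell. -/
noncomputable def cellPath {w : Equiv.Perm (Fin (n + 1))} {x : Conf n} (hx : ordPerm x = w) :
    Path (w • baseConf n) x :=
  segPath _ _ (convex_cellSet w) (cellSet_subset_confSet w) (smul_baseConf_mem_cellSet w)
    (mem_cellSet_iff.mpr hx)

theorem cellPath_mem {w : Equiv.Perm (Fin (n + 1))} {x : Conf n} (hx : ordPerm x = w)
    (t : unitInterval) : (cellPath hx t).1 ∈ cellSet w :=
  segPath_mem _ _ _ _ _ _ (convex_cellSet w) (smul_baseConf_mem_cellSet w)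
    (mem_cellSet_iff.mpr hx) t

/-- The image of `cellPath` in the complement of the discriminant. -/
noncomputable def basePath {w : Equiv.Perm (Fin (n + 1))} {x : Conf n} (hx : ordPerm x = w) :
    Path (toCoeff (baseConf n)) (toCoeff x) :=
  ((cellPath hx).map continuous_toCoeff).cast (toCoeff_smul w _).symm rfl

theorem basePath_apply {w : Equiv.Perm (Fin (n + 1))} {x : Conf n} (hx : ordPerm x = w)
    (t : unitInterval) : basePath hx t = toCoeff (cellPath hx t) := rfl

/-- The fundamental group of the complement of the discriminant, with loops composed from left to
right. -/
abbrev DiscrGroup (n : ℕ) : Type :=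
  (FundamentalGroup (DiscrCompl n) (toCoeff (baseConf n)))ᵐᵒᵖ

/-- The class of the image of a path of configurations, closed up to a loop by `basePath`. -/
noncomputable def loopClass {x y : Conf n} (γ : Path x y) : DiscrGroup n :=
  MulOpposite.op (pathArrow (basePath (Eq.refl (ordPerm x))) ≫
    pathArrow (γ.map continuous_toCoeff) ≫ inv (pathArrow (basePath (Eq.refl (ordPerm y)))))

theorem loopClass_eq {x y : Conf n} {γ : Path x y} {u v : Equiv.Perm (Fin (n + 1))}
    (hx : ordPerm x = u) (hy : ordPerm y = v) :
    loopClass γ = MulOpposite.op (pathArrow (basePath hx) ≫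
      pathArrow (γ.map continuous_toCoeff) ≫ inv (pathArrow (basePath hy))) := by
  subst hx hy
  rfl

theorem loopClass_refl (x : Conf n) : loopClass (Path.refl x) = 1 := by
  have h : pathArrow ((Path.refl x).map continuous_toCoeff) = 𝟙 _ := rfl
  rw [loopClass, h, Category.id_comp, IsIso.hom_inv_id]
  rfl

theorem loopClass_trans {x y z : Conf n} (γ : Path x y) (γ' : Path y z) :
    loopClass (γ.trans γ') = loopClass γ * loopClass γ' := by
  rw [loopClass, loopClass, loopClass, ← MulOpposite.op_mul, End.mul_def, Path.map_trans,
    pathArrow_trans]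
  simp

theorem loopClass_eq_of_homotopic {x y : Conf n} {γ γ' : Path x y} (h : γ.Homotopic γ') :
    loopClass γ = loopClass γ' := by
  rw [loopClass, loopClass, pathArrow_eq_of_homotopic (h.map ⟨_, continuous_toCoeff⟩)]

theorem loopClass_eq_of_mem_convex {x y : Conf n} {γ γ' : Path x y} {S : Set (Fin (n + 1) → ℂ)}
    (hS : Convex ℝ S) (hSc : S ⊆ confSet n) (h : ∀ t, (γ t).1 ∈ S) (h' : ∀ t, (γ' t).1 ∈ S) :
    loopClass γ = loopClass γ' :=
  loopClass_eq_of_homotopic (homotopic_of_mem_convex hS hSc h h')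

theorem cellPath_smul {w : Equiv.Perm (Fin (n + 1))} (v : Equiv.Perm (Fin (n + 1))) {x : Conf n}
    (hx : ordPerm x = w) {u : Equiv.Perm (Fin (n + 1))} (hu : ordPerm (v • x) = u)
    (t : unitInterval) : cellPath hu t = v • cellPath hx t := by
  subst hu hx
  refine Subtype.ext (funext fun i => ?_)
  simp [cellPath, segPath_val, AffineMap.lineMap_apply_module, ordPerm_smul]

/-- A path of configurations relabelled by a permutation. -/
noncomputable def smulPath (v : Equiv.Perm (Fin (n + 1))) {x y : Conf n} (γ : Path x y) :
    Path (v • x) (v • y) :=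
  γ.map (continuous_perm_smul v)

theorem loopClass_smulPath (v : Equiv.Perm (Fin (n + 1))) {x y : Conf n} (γ : Path x y) :
    loopClass (smulPath v γ) = loopClass γ := by
  rw [loopClass, loopClass]
  congr 1
  refine pathArrow_conj_congr (fun t => toCoeff_smul v (γ t)) (fun t => ?_) (fun t => ?_) <;>
  rw [basePath_apply, basePath_apply, cellPath_smul v rfl, toCoeff_smul]

theorem loopClass_eq_one {x y : Conf n} {γ : Path x y} {w : Equiv.Perm (Fin (n + 1))}
    (h : ∀ t, ordPerm (γ t) = w) : loopClass γ = 1 := by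
  have hx : ordPerm x = w := by simpa using h 0
  have hy : ordPerm y = w := by simpa using h 1
  have hγ : pathArrow (basePath hx) ≫ pathArrow (γ.map continuous_toCoeff) =
      pathArrow (basePath hy) := by
    rw [← pathArrow_trans]
    refine pathArrow_eq_of_homotopic ?_
    have := homotopic_of_mem_convex (γ := (cellPath hx).trans γ) (γ' := cellPath hy)
      (convex_cellSet w) (cellSet_subset_confSet w)
      (forall_trans_apply (p := fun z : Conf n => z.1 ∈ cellSet w) (cellPath_mem hx)
        fun t => mem_cellSet_iff.mpr (h t)) (cellPath_mem hy)
    have h₁ := (this.map ⟨_, continuous_toCoeff⟩).pathCast (toCoeff_smul w _).symm rfl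
    have h₂ : (basePath hx).trans (γ.map continuous_toCoeff) =
        (((cellPath hx).trans γ).map continuous_toCoeff).cast (toCoeff_smul w _).symm rfl := by
      refine Path.ext (funext fun t => ?_)
      rw [Path.cast_coe, Path.map_coe, Function.comp_apply, Path.trans_apply, Path.trans_apply]
      split_ifs <;> rfl
    rw [h₂]
    exact h₁
  rw [loopClass_eq hx hy, ← Category.assoc, hγ, IsIso.hom_inv_id]
  rfl

/-- A convex set containing the stars of `p` and `p'` within each cell, if `p` and `p'` lie in the
same cell. -/
def commonSet (p p' : Conf n) : Set (Fin (n + 1) → ℂ) :=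
  coneSet fun j k => {d | lexKey (p.1 j) < lexKey (p.1 k) →
    d ∈ {d | (p.1 j).re = (p.1 k).re ∧ (p'.1 j).re = (p'.1 k).re → d ∈ imPos} ∩
      {d | ¬((p.1 j).re = (p.1 k).re ∧ (p'.1 j).re = (p'.1 k).re) → d ∈ lexPos}}

theorem convex_commonSet (p p' : Conf n) : Convex ℝ (commonSet p p') :=
  convex_coneSet fun _ _ => convex_setOf_imp
    ((convex_setOf_imp convex_imPos).inter (convex_setOf_imp convex_lexPos))

theorem commonSet_subset_confSet (p p' : Conf n) : commonSet p p' ⊆ confSet n := by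
  have key (j k : Fin (n + 1)) (h : lexKey (p.1 j) < lexKey (p.1 k)) :
      (0 : ℂ) ∉ {d | lexKey (p.1 j) < lexKey (p.1 k) →
        d ∈ {d | (p.1 j).re = (p.1 k).re ∧ (p'.1 j).re = (p'.1 k).re → d ∈ imPos} ∩
          {d | ¬((p.1 j).re = (p.1 k).re ∧ (p'.1 j).re = (p'.1 k).re) → d ∈ lexPos}} := fun h₀ => by
    have h₁ := h₀ h
    by_cases hr : (p.1 j).re = (p.1 k).re ∧ (p'.1 j).re = (p'.1 k).re
    · exact zero_notMem_imPos (h₁.1 hr)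
    · exact zero_notMem_lexPos (h₁.2 hr)
  refine coneSet_subset_confSet fun j k hjk => ?_
  rcases lt_trichotomy (lexKey (p.1 j)) (lexKey (p.1 k)) with h | h | h
  · exact .inl (key j k h)
  · exact absurd (p.2.1 (lexKey_injective h)) hjk
  · exact .inr (key k j h)

theorem mem_commonSet {p p' x x' : Conf n} (hp : ordPerm p = ordPerm p')
    (hx : ordPerm x = ordPerm x') (h : x ∈ star p) (h' : x' ∈ star p') :
    x.1 ∈ commonSet p p' ∧ x'.1 ∈ commonSet p p' := by
  have hp' (j k) : lexKey (p.1 j) < lexKey (p.1 k) ↔ lexKey (p'.1 j) < lexKey (p'.1 k) := by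
    rw [← ordPerm_inv_lt_iff, ← ordPerm_inv_lt_iff, hp]
  have hx' (j k) : lexKey (x.1 j) < lexKey (x.1 k) ↔ lexKey (x'.1 j) < lexKey (x'.1 k) := by
    rw [← ordPerm_inv_lt_iff, ← ordPerm_inv_lt_iff, hx]
  have key (j k) (hl : lexKey (p.1 j) < lexKey (p.1 k))
      (hr : ¬((p.1 j).re = (p.1 k).re ∧ (p'.1 j).re = (p'.1 k).re)) :
      lexKey (x.1 j) < lexKey (x.1 k) := by
    rcases lexKey_lt_iff.mp hl with h₁ | h₁
    · exact lexKey_lt_iff.mpr (.inl ((mem_star.mp h j k).1 h₁))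
    rcases lexKey_lt_iff.mp ((hp' j k).mp hl) with h₂ | h₂
    · exact (hx' j k).mpr (lexKey_lt_iff.mpr (.inl ((mem_star.mp h' j k).1 h₂)))
    · exact absurd ⟨h₁.1, h₂.1⟩ hr
  refine ⟨⟨x.2.2, fun j k hl => ⟨fun hr => ?_, fun hr => ?_⟩⟩,
    ⟨x'.2.2, fun j k hl => ⟨fun hr => ?_, fun hr => ?_⟩⟩⟩
  · rw [sub_mem_imPos]
    exact (mem_star.mp h j k).2 ⟨hr.1, (lexKey_lt_iff.mp hl).resolve_left hr.1.not_lt |>.2⟩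
  · rw [sub_mem_lexPos]
    exact key j k hl hr
  · rw [sub_mem_imPos]
    exact (mem_star.mp h' j k).2
      ⟨hr.2, (lexKey_lt_iff.mp ((hp' j k).mp hl)).resolve_left hr.2.not_lt |>.2⟩
  · rw [sub_mem_lexPos, ← hx']
    exact key j k hl hr

/-- The straight path inside a star. -/
noncomputable def starPath {p x y : Conf n} (hx : x ∈ star p) (hy : y ∈ star p) : Path x y :=
  segPath x y (convex_starSet p) (starSet_subset_confSet p) hx hy

theorem starPath_mem {p x y : Conf n} (hx : x ∈ star p) (hy : y ∈ star p) (t : unitInterval) :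
    starPath hx hy t ∈ star p :=
  segPath_mem _ _ _ _ _ _ (convex_starSet p) hx hy t

theorem loopClass_eq_of_mem_star {p x y : Conf n} {γ γ' : Path x y} (h : ∀ t, γ t ∈ star p)
    (h' : ∀ t, γ' t ∈ star p) : loopClass γ = loopClass γ' :=
  loopClass_eq_of_mem_convex (convex_starSet p) (starSet_subset_confSet p) h h'

theorem loopClass_starPath_eq_of_ordPerm_eq {p p' x x' : Conf n} (hp : ordPerm p = ordPerm p')
    (hx : ordPerm x = ordPerm x') (h : x ∈ star p) (h' : x' ∈ star p') :
    loopClass (starPath (self_mem_star p) h) = loopClass (starPath (self_mem_star p') h') := by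
  obtain ⟨m₁, m₂⟩ := mem_commonSet hp hp (self_mem_star p) (self_mem_star p')
  obtain ⟨m₃, m₄⟩ := mem_commonSet hp hx h h'
  have hc := convex_commonSet p p'
  let α : Path p p' := segPath p p' (convex_cellSet (ordPerm p)) (cellSet_subset_confSet _)
    (mem_cellSet_iff.mpr rfl) (mem_cellSet_iff.mpr hp.symm)
  let β : Path x x' := segPath x x' (convex_cellSet (ordPerm x)) (cellSet_subset_confSet _)
    (mem_cellSet_iff.mpr rfl) (mem_cellSet_iff.mpr hx.symm)
  have hα : loopClass α = 1 := loopClass_eq_one (w := ordPerm p) fun t =>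
    mem_cellSet_iff.mp (segPath_mem _ _ _ _ _ _ (convex_cellSet _) (mem_cellSet_iff.mpr rfl)
      (mem_cellSet_iff.mpr hp.symm) t)
  have hβ : loopClass β = 1 := loopClass_eq_one (w := ordPerm x) fun t =>
    mem_cellSet_iff.mp (segPath_mem _ _ _ _ _ _ (convex_cellSet _) (mem_cellSet_iff.mpr rfl)
      (mem_cellSet_iff.mpr hx.symm) t)
  rw [← mul_one (loopClass _), ← hβ, ← loopClass_trans, ← one_mul (loopClass (starPath _ h')), ← hα,
    ← loopClass_trans]
  exact loopClass_eq_of_mem_convex hc (commonSet_subset_confSet p p')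
    (forall_trans_apply (p := fun z : Conf n => z.1 ∈ commonSet p p')
      (segPath_mem _ _ _ _ _ _ hc m₁ m₃) (segPath_mem _ _ _ _ _ _ hc m₃ m₄))
    (forall_trans_apply (p := fun z : Conf n => z.1 ∈ commonSet p p')
      (segPath_mem _ _ _ _ _ _ hc m₁ m₂) (segPath_mem _ _ _ _ _ _ hc m₂ m₄))

/-- The class of a path from the centre of a star depends only on the relative position of its
endpoints. -/
theorem loopClass_eq_of_relPerm_eq {p p' x x' : Conf n} {γ : Path p x} {γ' : Path p' x'}
    (hγ : ∀ t, γ t ∈ star p) (hγ' : ∀ t, γ' t ∈ star p') (h : relPerm p x = relPerm p' x') :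
    loopClass γ = loopClass γ' := by
  have hx : x ∈ star p := by simpa using hγ 1
  have hx' : x' ∈ star p' := by simpa using hγ' 1
  let w := ordPerm p * (ordPerm p')⁻¹
  have hp : ordPerm p = ordPerm (w • p') := by simp [ordPerm_smul, w]
  have hwx : ordPerm x = ordPerm (w • x') := by
    rw [ordPerm_smul, mul_assoc]
    change _ = ordPerm p * relPerm p' x'
    rw [← h, relPerm, mul_inv_cancel_left]
  rw [← loopClass_smulPath w γ',
    loopClass_eq_of_mem_star hγ (starPath_mem (self_mem_star p) hx),
    loopClass_starPath_eq_of_ordPerm_eq hp hwx hx (smul_mem_star hx')]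
  exact loopClass_eq_of_mem_star (starPath_mem _ _) fun t => smul_mem_star (hγ' t)

/-- The configuration of equidistant points on a vertical line. -/
noncomputable def columnConf (n : ℕ) : Conf n := rowConf (fun _ => 0) (by simp)

theorem rowConf_mem_star (f : Fin (n + 1) → ℝ) (hf : ∑ k, f k = 0) :
    rowConf f hf ∈ star (columnConf n) :=
  mem_star.mpr fun j k => by simp [columnConf]

/-- The configuration in the star of `columnConf` whose real parts are ordered by `w`. -/
noncomputable def slantConf (w : Equiv.Perm (Fin (n + 1))) : Conf n :=
  rowConf (fun k => basePt (w⁻¹ k)) (by rw [Equiv.sum_comp w⁻¹ basePt, sum_basePt])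

theorem slantConf_mem_star (w : Equiv.Perm (Fin (n + 1))) : slantConf w ∈ star (columnConf n) :=
  rowConf_mem_star _ _

theorem ordPerm_columnConf : ordPerm (columnConf n) = 1 :=
  ordPerm_eq fun _ _ h => lexKey_lt_iff.mpr (.inr ⟨rfl, basePt_strictMono h⟩)

theorem ordPerm_slantConf (w : Equiv.Perm (Fin (n + 1))) : ordPerm (slantConf w) = w :=
  ordPerm_eq_of_forall fun _ _ h => lexKey_lt_iff.mpr (.inl (basePt_strictMono h))

/-- The loop class attached to a permutation, as the image of a positive braid. -/
noncomputable def permLoop (w : Equiv.Perm (Fin (n + 1))) : DiscrGroup n :=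
  loopClass (starPath (self_mem_star _) (slantConf_mem_star w))

theorem loopClass_eq_permLoop {p x : Conf n} {γ : Path p x} (hγ : ∀ t, γ t ∈ star p) :
    loopClass γ = permLoop (relPerm p x) :=
  loopClass_eq_of_relPerm_eq hγ (starPath_mem _ _)
    (by rw [relPerm, relPerm, ordPerm_columnConf, ordPerm_slantConf, inv_one, one_mul])

@[simp] theorem permLoop_one : permLoop (1 : Equiv.Perm (Fin (n + 1))) = 1 := by
  rw [← loopClass_refl (columnConf n), loopClass_eq_permLoop (p := columnConf n), relPerm_self]
  exact fun _ => self_mem_star _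

theorem permLoop_mul_adjSwap {w : Equiv.Perm (Fin (n + 1))} {i : Fin n}
    (h : w i.castSucc < w i.succ) :
    permLoop (w * adjSwap i) = permLoop w * permLoop (adjSwap i) := by
  have e (k : Fin (n + 1)) : (w * adjSwap i)⁻¹ k = adjSwap i (w⁻¹ k) := by
    rw [mul_inv_rev, adjSwap_inv, Equiv.Perm.mul_apply]
  let f (k : Fin (n + 1)) : ℝ := (basePt (w⁻¹ k) + basePt ((w * adjSwap i)⁻¹ k)) / 2
  have hf : ∑ k, f k = 0 := by
    simp only [f]
    rw [← Finset.sum_div, Finset.sum_add_distrib, Equiv.sum_comp w⁻¹ basePt,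
      Equiv.sum_comp (w * adjSwap i)⁻¹ basePt, sum_basePt, add_zero, zero_div]
  have hlt {j k : Fin (n + 1)} (hjk : w⁻¹ j < w⁻¹ k) :
      (f j < f k ∧ adjSwap i (w⁻¹ j) < adjSwap i (w⁻¹ k)) ∨ (f j = f k ∧ j < k) := by
    have h₁ := basePt_strictMono hjk
    simp only [f, e]
    rcases adjSwap_lt hjk (i := i) with h₂ | ⟨h₂, h₃⟩
    · have := basePt_strictMono h₂
      exact .inl ⟨by linarith, h₂⟩
    · rw [Equiv.Perm.inv_eq_iff_eq] at h₂ h₃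
      subst h₂ h₃
      refine .inr ⟨?_, h⟩
      simp [add_comm]
  let q := rowConf f hf
  have hq : ordPerm q = w := ordPerm_eq_of_forall fun j k hjk => lexKey_lt_iff.mpr <| by
    rcases hlt hjk with h₁ | h₁
    · exact .inl h₁.1
    · exact .inr ⟨h₁.1, basePt_strictMono h₁.2⟩
  have hqp : q ∈ star (columnConf n) := rowConf_mem_star _ _
  have hx := slantConf_mem_star (w * adjSwap i)
  have hxq : slantConf (w * adjSwap i) ∈ star q := by
    refine mem_star.mpr fun j k => ⟨fun hjk => ?_, fun hjk => hjk.2⟩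
    change f j < f k at hjk
    change basePt _ < basePt _
    rw [e, e, basePt_lt_iff]
    rcases lt_trichotomy (w⁻¹ j) (w⁻¹ k) with h₁ | h₁ | h₁
    · exact ((hlt h₁).resolve_right fun h₂ => hjk.ne h₂.1).2
    · rw [w⁻¹.injective h₁] at hjk
      exact absurd hjk (lt_irrefl _)
    · rcases hlt h₁ with h₂ | h₂
      · exact absurd hjk h₂.1.not_gt
      · exact absurd hjk h₂.1.not_gt
  have h₁ : permLoop w = loopClass (starPath (self_mem_star (columnConf n)) hqp) := by
    rw [loopClass_eq_permLoop (starPath_mem _ _), relPerm, ordPerm_columnConf, hq, inv_one, one_mul]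
  have h₂ : permLoop (adjSwap i) = loopClass (starPath (self_mem_star q) hxq) := by
    rw [loopClass_eq_permLoop (starPath_mem _ _), relPerm, ordPerm_slantConf, hq,
      inv_mul_cancel_left]
  rw [h₁, h₂, ← loopClass_trans]
  refine loopClass_eq_of_mem_star (starPath_mem _ _) (forall_trans_apply (starPath_mem _ _) ?_)
  exact segPath_mem _ _ _ _ _ _ (convex_starSet (columnConf n)) hqp hx

theorem permLoop_adjSwap_comm {i j : Fin n} (h : (i : ℕ) + 1 < j) :
    permLoop (adjSwap i) * permLoop (adjSwap j) = permLoop (adjSwap j) * permLoop (adjSwap i) := by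
  rw [← permLoop_mul_adjSwap, ← permLoop_mul_adjSwap, adjSwap_comm h]
  · rw [adjSwap_of_ne, adjSwap_of_ne]
    · exact i.castSucc_lt_succ
    all_goals simp; omega
  · rw [adjSwap_of_ne, adjSwap_of_ne]
    · exact j.castSucc_lt_succ
    all_goals simp; omega

theorem permLoop_adjSwap_braid {i j : Fin n} (h : (i : ℕ) + 1 = j) :
    permLoop (adjSwap i) * permLoop (adjSwap j) * permLoop (adjSwap i) =
      permLoop (adjSwap j) * permLoop (adjSwap i) * permLoop (adjSwap j) := by
  have hij : i.succ = j.castSucc := Fin.ext (by simpa using h)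
  have hi : adjSwap j i.castSucc = i.castSucc := adjSwap_of_ne (by simp; omega) (by simp; omega)
  have hj : adjSwap i j.succ = j.succ := adjSwap_of_ne (by simp; omega) (by simp; omega)
  have lt₁ : i.castSucc < i.succ := i.castSucc_lt_succ
  have lt₂ : i.succ < j.succ := hij ▸ j.castSucc_lt_succ
  have h₁ : adjSwap j i.succ = j.succ := by rw [hij, adjSwap_castSucc]
  have h₂ : adjSwap j j.succ = i.succ := by rw [hij, adjSwap_succ]
  rw [← permLoop_mul_adjSwap, ← permLoop_mul_adjSwap, ← permLoop_mul_adjSwap,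
    ← permLoop_mul_adjSwap, adjSwap_braid h]
  all_goals simp only [Equiv.Perm.mul_apply, ← hij, adjSwap_castSucc, adjSwap_succ, hi, hj, h₁, h₂]
  exacts [lt₁, lt₁.trans lt₂, lt₂, lt₁.trans lt₂]

theorem pathArrow_inv {X : Type*} [TopologicalSpace X] {x y : X} (γ : Path x y) :
    inv (pathArrow γ) = pathArrow γ.symm := (Groupoid.inv_eq_inv _).symm

/-- The homomorphism sending a generator of the braid group to the corresponding half twist. -/
noncomputable def braidLoop : Braid n →* DiscrGroup n :=
  PresentedGroup.toGroup (f := fun i : Fin n => permLoop (adjSwap i)) (by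
    rintro r (⟨i, j, h, rfl⟩ | ⟨i, j, h, rfl⟩)
    · simpa using mul_inv_eq_one.mpr (permLoop_adjSwap_braid h)
    · simpa using mul_inv_eq_one.mpr (permLoop_adjSwap_comm h))

@[simp] theorem braidLoop_braidGen (i : Fin n) : braidLoop (braidGen i) = permLoop (adjSwap i) :=
  PresentedGroup.toGroup.of _

theorem braidLoop_braidLift (w : Equiv.Perm (Fin (n + 1))) :
    braidLoop (braidLift w) = permLoop w := by
  induction w using perm_ascent_induction with
  | one => simp
  | mul w i hi ih => rw [braidLift_mul_adjSwap hi, permLoop_mul_adjSwap hi, _root_.map_mul, ih,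
      braidLoop_braidGen]

theorem loopClass_mem_range_of_mem_star {p x y : Conf n} {γ : Path x y} (h : ∀ t, γ t ∈ star p) :
    loopClass γ ∈ (braidLoop : Braid n →* DiscrGroup n).range := by
  have hx : x ∈ star p := by simpa using h 0
  have h₁ : permLoop (relPerm p x) * loopClass γ = permLoop (relPerm p y) := by
    rw [← loopClass_eq_permLoop (starPath_mem (self_mem_star p) hx), ← loopClass_trans]
    exact loopClass_eq_permLoop (forall_trans_apply (starPath_mem _ _) h)
  rw [← inv_mul_eq_iff_eq_mul.mpr h₁.symm, ← braidLoop_braidLift, ← braidLoop_braidLift, ← _root_.map_inv,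
    ← _root_.map_mul]
  exact ⟨_, rfl⟩

theorem loopClass_cast {x y x' y' : Conf n} (γ : Path x y) (hx : x' = x) (hy : y' = y) :
    loopClass (γ.cast hx hy) = loopClass γ := by
  subst hx hy
  rfl

theorem loopClass_mem_range {x y : Conf n} (γ : Path x y) :
    loopClass γ ∈ (braidLoop : Braid n →* DiscrGroup n).range := by
  obtain ⟨t, h₀, ht, ⟨N, hN⟩, hc⟩ := exists_monotone_Icc_subset_open_cover_unitInterval
    (c := fun p : Conf n => γ ⁻¹' star p) (fun p => (isOpen_star p).preimage γ.continuous)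
    fun s _ => Set.mem_iUnion.mpr ⟨γ s, self_mem_star _⟩
  have key (k : ℕ) : loopClass (γ.subpath 0 (t k)) ∈
      (braidLoop : Braid n →* DiscrGroup n).range := by
    induction k with
    | zero =>
      rw [h₀, Path.subpath_self, loopClass_refl]
      exact one_mem _
    | succ k ih =>
      obtain ⟨p, hp⟩ := hc k
      rw [← loopClass_eq_of_homotopic ⟨Path.Homotopy.subpathTransSubpath γ 0 (t k) (t (k + 1))⟩,
        loopClass_trans]
      refine mul_mem ih (loopClass_mem_range_of_mem_star (p := p) fun s => ?_)
      have hs : γ.subpath (t k) (t (k + 1)) s ∈ Set.range (γ.subpath (t k) (t (k + 1))) := ⟨s, rfl⟩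
      rw [Path.range_subpath, Set.uIcc_of_le (ht k.le_succ)] at hs
      obtain ⟨r, hr, hrs⟩ := hs
      rw [← hrs]
      exact hp hr
  have h₁ := key N
  rwa [hN N le_rfl, Path.subpath_zero_one, loopClass_cast] at h₁

theorem toCoeff_cellPath {z : Conf n} (hz : toCoeff z = toCoeff (baseConf n))
    (t : unitInterval) : toCoeff (cellPath (Eq.refl (ordPerm z)) t) = toCoeff (baseConf n) := by
  obtain ⟨w, rfl⟩ := toCoeff_eq_iff.mp hz
  have h : ordPerm (w • baseConf n) = w := by rw [ordPerm_smul, ordPerm_baseConf, mul_one]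
  have h₁ : cellPath (Eq.refl (ordPerm (w • baseConf n))) t = w • baseConf n :=
    Subtype.ext (by simp [cellPath, segPath_val, h])
  rw [h₁, hz]

theorem loopClass_eq_op_pathArrow {z : Conf n} (γ : Path (baseConf n) z)
    (hz : toCoeff z = toCoeff (baseConf n)) :
    loopClass γ = MulOpposite.op (pathArrow ((γ.map continuous_toCoeff).cast rfl hz.symm)) := by
  have hc (t) : basePath (Eq.refl (ordPerm (baseConf n))) t =
      Path.refl (toCoeff (baseConf n)) t := by
    rw [basePath_apply, toCoeff_cellPath rfl]
    rfl
  have hd (t) : basePath (Eq.refl (ordPerm z)) t = Path.refl (toCoeff (baseConf n)) t := by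
    rw [basePath_apply, toCoeff_cellPath hz]
    rfl
  rw [loopClass, pathArrow_conj_congr (γ := γ.map continuous_toCoeff)
    (γ' := (γ.map continuous_toCoeff).cast rfl hz.symm)
    (fun _ => rfl) hc hd]
  simp [pathArrow_refl]

/-- The base point of `BraidCover n`, in the fibre of the base point of the complement of the
discriminant. -/
noncomputable def baseCover (n : ℕ) :
    (fun e : BraidCover n => toCoeff e.conf) ⁻¹' {toCoeff (baseConf n)} :=
  ⟨⟨1, baseConf n⟩, rfl⟩

theorem braidLoop_surjective :
    Function.Surjective (braidLoop : Braid n →* DiscrGroup n) := by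
  rintro ⟨α⟩
  obtain ⟨a, rfl⟩ := Path.Homotopic.Quotient.mk_surjective α
  have cov := (isQuotientCoveringMap_toCoeff_conf (n := n)).isCoveringMap
  have h := cov.map_liftPathQuotient (Path.Homotopic.Quotient.mk a) (baseCover n)
  obtain ⟨Γ, hΓ⟩ := Path.Homotopic.Quotient.mk_surjective
    (cov.liftPathQuotient (Path.Homotopic.Quotient.mk a) (baseCover n))
  rw [← hΓ] at h
  have h₁ := loopClass_eq_op_pathArrow (Γ.map continuous_braidCover_conf)
    (cov.monodromy (Path.Homotopic.Quotient.mk a) (baseCover n)).2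
  obtain ⟨g, hg⟩ := loopClass_mem_range (Γ.map continuous_braidCover_conf)
  refine ⟨g, hg.trans (h₁.trans (congrArg MulOpposite.op ?_))⟩
  exact pathArrow_eq_of_homotopic ((Path.Homotopic.Quotient.exact h).pathCast rfl _)

/-- The braid traced by a loop in the complement of the discriminant. -/
noncomputable def traceBraid : DiscrGroup n →* Braid n where
  toFun α := (isQuotientCoveringMap_toCoeff_conf.fundamentalGroupToMulOpposite (baseCover n)
    α.unop).unop.1
  map_one' := by rw [MulOpposite.unop_one, _root_.map_one]; rfl
  map_mul' α β := by rw [MulOpposite.unop_mul, _root_.map_mul]; rfl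

/-- The lift of `cellPath` to a sheet of the covering. -/
noncomputable def cellLift (g : Braid n) {w : Equiv.Perm (Fin (n + 1))} {x : Conf n}
    (hx : ordPerm x = w) : Path (⟨g, w • baseConf n⟩ : BraidCover n) ⟨g, x⟩ where
  toFun t := ⟨g, cellPath hx t⟩
  continuous_toFun := continuous_braidCover_mk_of_ordPerm_eq g (cellPath hx).continuous fun s t =>
    (mem_cellSet_iff.mp (cellPath_mem hx s)).trans (mem_cellSet_iff.mp (cellPath_mem hx t)).symm
  source' := by simp
  target' := by simp

theorem traceBraid_loopClass {x y : Conf n} {γ : Path x y} (hx : ordPerm x = 1) {g : Braid n}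
    (Γ : Path (⟨1, x⟩ : BraidCover n) ⟨g, y⟩) (hΓ : ∀ t, (Γ t).conf = γ t) :
    traceBraid (loopClass γ) = g := by
  have hp := isQuotientCoveringMap_toCoeff_conf (n := n)
  let v : Braid n × Equiv.Perm (Fin (n + 1)) := (g, ordPerm y)
  have hb : (baseCover n).1 = ⟨1, (1 : Equiv.Perm (Fin (n + 1))) • baseConf n⟩ := by
    rw [one_smul]; rfl
  have hv : v • (baseCover n).1 = ⟨g, ordPerm y • baseConf n⟩ :=
    BraidCover.ext (mul_one g) rfl
  let Δ : Path (baseCover n).1 (v • (baseCover n).1) :=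
    ((cellLift 1 hx).trans (Γ.trans (cellLift g (Eq.refl (ordPerm y))).symm)).cast hb hv
  let a : Path (toCoeff (baseConf n)) (toCoeff (baseConf n)) :=
    (basePath hx).trans ((γ.map continuous_toCoeff).trans (basePath (Eq.refl (ordPerm y))).symm)
  have ha : loopClass γ = MulOpposite.op (pathArrow a) := by
    rw [loopClass_eq hx rfl, pathArrow_inv]
    rfl
  have hΔ (t) : toCoeff (Δ t).conf = a t := by
    simp only [Δ, a, Path.cast_coe, Path.trans_apply]
    split_ifs
    · rfl
    · rw [hΓ]; rfl
    · rfl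
  have hm : (hp.isCoveringMap.monodromy (Path.Homotopic.Quotient.mk a) (baseCover n)) =
      ⟨v • (baseCover n).1, toCoeff_smul _ _⟩ :=
    hp.isCoveringMap.monodromy_eq_of_map_eq (Path.Homotopic.Quotient.mk Δ)
      (congrArg Path.Homotopic.Quotient.mk (Path.ext (funext hΔ)))
  have h := (hp.fundamentalGroupToMulOpposite_apply_eq_Iff (γ := Path.Homotopic.Quotient.mk a)
    (e := baseCover n) (g := MulOpposite.op v)).mpr (congrArg Subtype.val hm).symm
  rw [ha]
  exact congrArg (fun q => q.unop.1) h

theorem traceBraid_permLoop (w : Equiv.Perm (Fin (n + 1))) :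
    traceBraid (permLoop w) = braidLift w := by
  refine traceBraid_loopClass ordPerm_columnConf ⟨⟨fun t => ⟨_, _⟩,
    continuous_braidCover_mk_of_mem_star 1 (starPath (self_mem_star _)
    (slantConf_mem_star w)).continuous (p := columnConf n) (starPath_mem _ _)⟩, ?_, ?_⟩
    fun _ => rfl
  · simp
  · simp [braidStep, relPerm, ordPerm_columnConf, ordPerm_slantConf]

theorem traceBraid_braidLoop (g : Braid n) : traceBraid (braidLoop g) = g := by
  have : (traceBraid.comp braidLoop : Braid n →* Braid n) = MonoidHom.id _ :=
    PresentedGroup.ext fun i => by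
      change traceBraid (braidLoop (braidGen i)) = braidGen i
      rw [braidLoop_braidGen, traceBraid_permLoop, braidLift_adjSwap]
  exact DFunLike.congr_fun this g

/-- The fundamental group of the complement of the discriminant is the braid group. -/
noncomputable def braidEquiv : Braid n ≃* DiscrGroup n :=
  MulEquiv.ofBijective braidLoop
    ⟨Function.LeftInverse.injective traceBraid_braidLoop, braidLoop_surjective⟩

theorem nonempty_fundamentalGroup_mulEquiv_braid (u : DiscrCompl n) :
    Nonempty (FundamentalGroup (DiscrCompl n) u ≃* Braid n) := by
  obtain ⟨x, rfl⟩ := toCoeff_surjective u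
  exact ⟨(FundamentalGroup.fundamentalGroupMulEquivOfPath (basePath (Eq.refl (ordPerm x)))).symm.trans
    ((MulEquiv.inv' _).trans braidEquiv.symm)⟩

end

/-- The fundamental group of the discriminant complement of the versal
unfolding of the `A_n`-singularity `x^{n+1}` is isomorphic to the Artin braid group on
`n + 1` strands, presented by `n` generators and the braid relations. -/
theorem statement1 (n : ℕ) (hn : 1 ≤ n) (u₀ : Fin n → ℂ) (hu₀ : u₀ ∉ Discr n) :
    Nonempty
      ((FundamentalGroup {u : Fin n → ℂ // u ∉ Discr n}
          (⟨u₀, hu₀⟩ : {u : Fin n → ℂ // u ∉ Discr n})) ≃*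
        PresentedGroup (artinRels n)) := by
  exact nonempty_fundamentalGroup_mulEquiv_braid ⟨u₀, hu₀⟩

end Stmt1
end

section
/- Let l_1, …, l_n ≥ 1 be integers and a ∈ ℂ^n with a_ν ≠ 0 for all ν; set α_ν = a_ν^{l_ν} and f_α(x) = Σ_{ν=1}^n (x_ν^{l_ν+1} − (l_ν+1) α_ν x_ν). Then f_α takes the same value at two distinct critical points if and only if there exist tuples ζ ≠ η in ℂ^n with ζ_ν^{l_ν} = η_ν^{l_ν} = 1 for all ν and Σ_{ν=1}^n l_ν a_ν^{l_ν+1}(ζ_ν − η_ν) = 0; equivalently, f_α is injective on its critical set if and only if the Hefez–Lazzeri product Π_{ζ ≠ η} ( Σ_ν l_ν a_ν^{l_ν+1}(ζ_ν − η_ν) ), taken over all ordered pairs of distinct such tuples, is nonzero. -/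
namespace Stmt4

/-- The Hefez–Lazzeri perturbation `f_α(x) = Σ_ν (x_ν^{l_ν+1} − (l_ν+1) α_ν x_ν)` of the
Brieskorn–Pham polynomial, with `α_ν = a_ν^{l_ν}`. -/
noncomputable def fHL (n : ℕ) (l : Fin n → ℕ) (a : Fin n → ℂ) (x : Fin n → ℂ) : ℂ :=
  ∑ ν, (x ν ^ (l ν + 1) - ((l ν : ℂ) + 1) * a ν ^ l ν * x ν)

/-- `x` is a critical point of `f_α`: all partial derivatives vanish at `x`. -/
def IsCritPt (n : ℕ) (l : Fin n → ℕ) (a : Fin n → ℂ) (x : Fin n → ℂ) : Prop :=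
  ∀ ν, deriv (fun t => fHL n l a (Function.update x ν t)) (x ν) = 0

/-- The critical points of `f_α` are the solutions of `x_ν ^ l_ν = a_ν ^ l_ν`. -/
theorem isCritPt_iff (n : ℕ) (l : Fin n → ℕ) (a x : Fin n → ℂ) :
    IsCritPt n l a x ↔ ∀ ν, x ν ^ l ν = a ν ^ l ν := by
  refine forall_congr' fun ν => ?_
  have hd : HasDerivAt (fun t => fHL n l a (Function.update x ν t))
      (((l ν : ℂ) + 1) * (x ν ^ l ν - a ν ^ l ν)) (x ν) := by
    have hupd := hasDerivAt_pi.1 (hasDerivAt_update x ν (x ν))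
    have hsum : HasDerivAt (fun t => fHL n l a (Function.update x ν t)) _ (x ν) :=
      HasDerivAt.fun_sum (u := Finset.univ) fun μ _ =>
        ((hupd μ).fun_pow (l μ + 1)).sub ((hupd μ).const_mul (((l μ : ℂ) + 1) * a μ ^ l μ))
    refine hsum.congr_deriv ?_
    rw [Finset.sum_eq_single ν]
    · simp
      ring
    · intro μ _ hμ
      simp [hμ]
    · simp
  rw [hd.deriv, mul_eq_zero, or_iff_right (Nat.cast_add_one_ne_zero (l ν)), sub_eq_zero]

theorem isCritPt_mul (n : ℕ) (l : Fin n → ℕ) (a ζ : Fin n → ℂ) (hζ : ∀ ν, ζ ν ^ l ν = 1) :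
    IsCritPt n l a (a * ζ) :=
  (isCritPt_iff n l a _).2 fun ν => by simp [mul_pow, hζ ν]

theorem exists_eq_mul_of_isCritPt (n : ℕ) (l : Fin n → ℕ) (a : Fin n → ℂ) (ha : ∀ ν, a ν ≠ 0)
    (x : Fin n → ℂ) (hx : IsCritPt n l a x) :
    ∃ ζ : Fin n → ℂ, (∀ ν, ζ ν ^ l ν = 1) ∧ x = a * ζ := by
  refine ⟨x / a, fun ν => ?_, funext fun ν => ?_⟩
  · simp [div_pow, (isCritPt_iff n l a x).1 hx ν, ha ν]
  · simp [mul_div_cancel₀, ha ν]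

/-- The critical value at `a * ζ`. -/
theorem fHL_mul (n : ℕ) (l : Fin n → ℕ) (a ζ : Fin n → ℂ) (hζ : ∀ ν, ζ ν ^ l ν = 1) :
    fHL n l a (a * ζ) = -∑ ν, (l ν : ℂ) * a ν ^ (l ν + 1) * ζ ν := by
  rw [fHL, ← Finset.sum_neg_distrib]
  refine Finset.sum_congr rfl fun ν _ => ?_
  rw [Pi.mul_apply, mul_pow, pow_succ (ζ ν), hζ ν]
  ring

theorem fHL_mul_eq_iff (n : ℕ) (l : Fin n → ℕ) (a ζ η : Fin n → ℂ)
    (hζ : ∀ ν, ζ ν ^ l ν = 1) (hη : ∀ ν, η ν ^ l ν = 1) :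
    fHL n l a (a * ζ) = fHL n l a (a * η) ↔
      ∑ ν, (l ν : ℂ) * a ν ^ (l ν + 1) * (ζ ν - η ν) = 0 := by
  rw [fHL_mul n l a ζ hζ, fHL_mul n l a η hη, neg_inj, ← sub_eq_zero, ← Finset.sum_sub_distrib]
  simp only [mul_sub]

theorem exists_isCritPt_ne_iff (n : ℕ) (l : Fin n → ℕ) (a : Fin n → ℂ) (ha : ∀ ν, a ν ≠ 0) :
    (∃ x y : Fin n → ℂ, x ≠ y ∧ IsCritPt n l a x ∧ IsCritPt n l a y ∧
        fHL n l a x = fHL n l a y) ↔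
      (∃ ζ η : Fin n → ℂ, (∀ ν, ζ ν ^ l ν = 1) ∧ (∀ ν, η ν ^ l ν = 1) ∧ ζ ≠ η ∧
        ∑ ν, (l ν : ℂ) * a ν ^ (l ν + 1) * (ζ ν - η ν) = 0) := by
  constructor
  · rintro ⟨x, y, hxy, hx, hy, h⟩
    obtain ⟨ζ, hζ, rfl⟩ := exists_eq_mul_of_isCritPt n l a ha x hx
    obtain ⟨η, hη, rfl⟩ := exists_eq_mul_of_isCritPt n l a ha y hy
    exact ⟨ζ, η, hζ, hη, fun h' => hxy (h' ▸ rfl), (fHL_mul_eq_iff n l a ζ η hζ hη).1 h⟩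
  · rintro ⟨ζ, η, hζ, hη, hne, h⟩
    refine ⟨a * ζ, a * η, fun h' => hne (funext fun ν => ?_), isCritPt_mul n l a ζ hζ,
      isCritPt_mul n l a η hη, (fHL_mul_eq_iff n l a ζ η hζ hη).2 h⟩
    exact mul_left_cancel₀ (ha ν) (congrFun h' ν)

theorem finite_setOf_pow_eq_one {ι : Type*} [Finite ι] (l : ι → ℕ) (hl : ∀ i, 1 ≤ l i) :
    {ζ : ι → ℂ | ∀ i, ζ i ^ l i = 1}.Finite := by
  refine Set.Finite.pi' (t := fun i => {z : ℂ | z ^ l i = 1}) fun i => ?_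
  refine (Polynomial.nthRoots (l i) (1 : ℂ)).toFinset.finite_toSet.subset fun z hz => ?_
  simpa [Polynomial.mem_nthRoots (hl i)] using hz

/-- `f_α` takes the same value at two distinct critical points iff there are
tuples `ζ ≠ η` of roots of unity with `Σ_ν l_ν a_ν^{l_ν+1}(ζ_ν − η_ν) = 0`; equivalently,
`f_α` is injective on its critical set iff the Hefez–Lazzeri product over all ordered pairs
of distinct such tuples is nonzero. -/
theorem statement4 (n : ℕ) (l : Fin n → ℕ) (hl : ∀ ν, 1 ≤ l ν) (a : Fin n → ℂ)
    (ha : ∀ ν, a ν ≠ 0) :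
    ((∃ x y : Fin n → ℂ, x ≠ y ∧ IsCritPt n l a x ∧ IsCritPt n l a y ∧
        fHL n l a x = fHL n l a y) ↔
      (∃ ζ η : Fin n → ℂ, (∀ ν, ζ ν ^ l ν = 1) ∧ (∀ ν, η ν ^ l ν = 1) ∧ ζ ≠ η ∧
        ∑ ν, (l ν : ℂ) * a ν ^ (l ν + 1) * (ζ ν - η ν) = 0)) ∧
    (Set.InjOn (fHL n l a) {x : Fin n → ℂ | IsCritPt n l a x} ↔
      (∏ᶠ p : {p : (Fin n → ℂ) × (Fin n → ℂ) //
          (∀ ν, p.1 ν ^ l ν = 1) ∧ (∀ ν, p.2 ν ^ l ν = 1) ∧ p.1 ≠ p.2},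
        ∑ ν, (l ν : ℂ) * a ν ^ (l ν + 1) * (p.1.1 ν - p.1.2 ν)) ≠ 0) := by
  refine ⟨exists_isCritPt_ne_iff n l a ha, ?_⟩
  have hfin := finite_setOf_pow_eq_one l hl
  have : Finite {p : (Fin n → ℂ) × (Fin n → ℂ) //
      (∀ ν, p.1 ν ^ l ν = 1) ∧ (∀ ν, p.2 ν ^ l ν = 1) ∧ p.1 ≠ p.2} :=
    ((hfin.prod hfin).subset fun _ hp => ⟨hp.1, hp.2.1⟩ :
      {p : (Fin n → ℂ) × (Fin n → ℂ) |
        (∀ ν, p.1 ν ^ l ν = 1) ∧ (∀ ν, p.2 ν ^ l ν = 1) ∧ p.1 ≠ p.2}.Finite).to_subtype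
  cases nonempty_fintype {p : (Fin n → ℂ) × (Fin n → ℂ) //
      (∀ ν, p.1 ν ^ l ν = 1) ∧ (∀ ν, p.2 ν ^ l ν = 1) ∧ p.1 ≠ p.2}
  rw [finprod_eq_prod_of_fintype, Finset.prod_ne_zero_iff]
  constructor
  · rintro hinj ⟨⟨ζ, η⟩, hζ, hη, hne⟩ - h
    obtain ⟨x, y, hxy, hx, hy, hf⟩ :=
      (exists_isCritPt_ne_iff n l a ha).2 ⟨ζ, η, hζ, hη, hne, h⟩
    exact hxy (hinj hx hy hf)
  · intro hprod x hx y hy hf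
    by_contra hxy
    obtain ⟨ζ, η, hζ, hη, hne, h⟩ :=
      (exists_isCritPt_ne_iff n l a ha).1 ⟨x, y, hxy, hx, hy, hf⟩
    exact hprod ⟨(ζ, η), hζ, hη, hne⟩ (Finset.mem_univ _) h

end Stmt4
end

section
/- Let n ≥ 2, let l be an integer, and suppose β = β₀ ∘ σ_1^l ∘ β₀^{-1} ∈ Br_n for some β₀ ∈ Br_n. Then the normal subgroup of F_n generated by the n elements t_i^{-1}·β(t_i), i = 1, …, n, equals the normal subgroup of F_n generated by the two elements β₀(t_1)^{-1}·β₀(σ_1^l(t_1)) and β₀(t_2)^{-1}·β₀(σ_1^l(t_2)). -/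
open FreeGroup

namespace ArtinBase

/-- The endomorphism of the free group underlying the Artin half-twist on strands `a`, `b`. -/
def preArtin {n : ℕ} (a b : Fin n) : FreeGroup (Fin n) →* FreeGroup (Fin n) :=
  FreeGroup.lift fun j =>
    if j = a then of a * of b * (of a)⁻¹ else if j = b then of a else of j

def preArtinInv {n : ℕ} (a b : Fin n) : FreeGroup (Fin n) →* FreeGroup (Fin n) :=
  FreeGroup.lift fun j =>
    if j = a then of b else if j = b then (of b)⁻¹ * of a * of b else of j

theorem preArtin_inv_comp {n : ℕ} (a b : Fin n) (hab : a ≠ b) :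
    (preArtinInv a b).comp (preArtin a b) = MonoidHom.id _ := by
  apply FreeGroup.ext_hom
  intro j
  simp only [MonoidHom.comp_apply, MonoidHom.id_apply]
  by_cases hja : j = a
  · subst hja
    simp [preArtin, preArtinInv, Ne.symm hab, hab]
    group
  · by_cases hjb : j = b
    · subst hjb
      simp [preArtin, preArtinInv, hja]
    · simp [preArtin, preArtinInv, hja, hjb]

theorem preArtin_comp_inv {n : ℕ} (a b : Fin n) (hab : a ≠ b) :
    (preArtin a b).comp (preArtinInv a b) = MonoidHom.id _ := by
  apply FreeGroup.ext_hom
  intro j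
  simp only [MonoidHom.comp_apply, MonoidHom.id_apply]
  by_cases hja : j = a
  · subst hja
    simp [preArtin, preArtinInv, Ne.symm hab]
  · by_cases hjb : j = b
    · subst hjb
      simp [preArtin, preArtinInv, hja, Ne.symm hab]
      group
    · simp [preArtin, preArtinInv, hja, hjb]

/-- The Artin (half-twist) automorphism of the free group, for a pair of distinct indices. -/
def artin {n : ℕ} (a b : Fin n) (hab : a ≠ b) : MulAut (FreeGroup (Fin n)) where
  toFun := preArtin a b
  invFun := preArtinInv a b
  left_inv x := by simpa using DFunLike.congr_fun (preArtin_inv_comp a b hab) x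
  right_inv x := by simpa using DFunLike.congr_fun (preArtin_comp_inv a b hab) x
  map_mul' := map_mul _

/-- The `i`-th Artin generator `σ_i` (0-indexed) of the braid group acting on `F_n`. -/
def σgen (n i : ℕ) (h : i + 1 < n) : MulAut (FreeGroup (Fin n)) :=
  artin ⟨i, Nat.lt_of_succ_lt h⟩ ⟨i + 1, h⟩ (Fin.ne_of_lt (Fin.mk_lt_mk.mpr (Nat.lt_succ_self i)))

/-- Totalized Artin generator (being `1` out of range). -/
def σgenN (n i : ℕ) : MulAut (FreeGroup (Fin n)) :=
  if h : i + 1 < n then σgen n i h else 1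

/-- The braid group on `n` strands, realized as the subgroup of `Aut (F_n)` generated by the
Artin generators. -/
def BraidGroup (n : ℕ) : Subgroup (MulAut (FreeGroup (Fin n))) :=
  Subgroup.closure {β | ∃ i : ℕ, i + 1 < n ∧ β = σgenN n i}

/-- The band generator `σ_{i,j}` (0-indexed strands `i < j`). -/
def bandσ (n i j : ℕ) : MulAut (FreeGroup (Fin n)) :=
  (((List.range (j - (i + 1))).map fun k => σgenN n (j - 1 - k)).prod) * σgenN n i *
    (((List.range (j - (i + 1))).map fun k => σgenN n (j - 1 - k)).prod)⁻¹


/-- Two homomorphisms out of a free group that agree on generators modulo a normal subgroup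
agree everywhere modulo it. -/
theorem inv_mul_mem_of_forall_of {α G : Type*} [Group G] (N : Subgroup G) [N.Normal]
    (f g : FreeGroup α →* G) (h : ∀ i, (f (of i))⁻¹ * g (of i) ∈ N) (x : FreeGroup α) :
    (f x)⁻¹ * g x ∈ N := by
  have key : (QuotientGroup.mk' N).comp f = (QuotientGroup.mk' N).comp g :=
    FreeGroup.ext_hom _ _ fun i => QuotientGroup.eq.mpr (h i)
  exact QuotientGroup.eq.mp (DFunLike.congr_fun key x)

theorem artin_zpow_of_ne {n : ℕ} {a b : Fin n} (hab : a ≠ b) {j : Fin n} (hja : j ≠ a)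
    (hjb : j ≠ b) (l : ℤ) : (artin a b hab ^ l) (of j) = of j := by
  have h : artin a b hab ∈ MulAction.stabilizer (MulAut (FreeGroup (Fin n))) (of j) := by
    change preArtin a b (of j) = of j
    simp [preArtin, hja, hjb]
  exact zpow_mem h l

/-- If `β = β₀ σ₁^l β₀⁻¹` in `Br_n`, then the normal subgroup of `F_n`
generated by the `n` elements `t_i⁻¹ · β(t_i)` equals the normal subgroup generated by the
two elements `β₀(t_1)⁻¹ · β₀(σ₁^l(t_1))` and `β₀(t_2)⁻¹ · β₀(σ₁^l(t_2))`
(here `t_1, t_2` are the generators `of 0, of 1` and `σ₁ = σgen n 0`). -/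
theorem statement8 (n : ℕ) (hn : 2 ≤ n) (l : ℤ)
    (β₀ β : MulAut (FreeGroup (Fin n))) (hβ₀ : β₀ ∈ BraidGroup n)
    (hβ : β = β₀ * (σgen n 0 (by omega)) ^ l * β₀⁻¹) :
    Subgroup.normalClosure {x : FreeGroup (Fin n) | ∃ i : Fin n, x = (of i)⁻¹ * β (of i)} =
      Subgroup.normalClosure
        {(β₀ (of (⟨0, by omega⟩ : Fin n)))⁻¹ *
            β₀ (((σgen n 0 (by omega)) ^ l) (of (⟨0, by omega⟩ : Fin n))),
         (β₀ (of (⟨1, by omega⟩ : Fin n)))⁻¹ *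
            β₀ (((σgen n 0 (by omega)) ^ l) (of (⟨1, by omega⟩ : Fin n)))} := by
  subst hβ
  set s : MulAut (FreeGroup (Fin n)) := σgen n 0 (by omega) ^ l
  apply le_antisymm
  · refine Subgroup.normalClosure_le_normal ?_
    rintro _ ⟨i, rfl⟩
    have h := inv_mul_mem_of_forall_of
      (Subgroup.normalClosure
        {(β₀ (of (⟨0, by omega⟩ : Fin n)))⁻¹ * β₀ (s (of (⟨0, by omega⟩ : Fin n))),
         (β₀ (of (⟨1, by omega⟩ : Fin n)))⁻¹ * β₀ (s (of (⟨1, by omega⟩ : Fin n)))})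
      β₀.toMonoidHom (β₀ * s).toMonoidHom ?_ (β₀⁻¹ (of i))
    · simpa using h
    · intro j
      by_cases h0 : j = ⟨0, by omega⟩
      · subst h0
        exact Subgroup.subset_normalClosure (Or.inl rfl)
      by_cases h1 : j = ⟨1, by omega⟩
      · subst h1
        exact Subgroup.subset_normalClosure (Or.inr rfl)
      have hj : s (of j) = of j := artin_zpow_of_ne _ h0 h1 l
      simp [hj]
  · have h := inv_mul_mem_of_forall_of
      (Subgroup.normalClosure
        {x : FreeGroup (Fin n) | ∃ i : Fin n, x = (of i)⁻¹ * (β₀ * s * β₀⁻¹) (of i)})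
      (MonoidHom.id _) (β₀ * s * β₀⁻¹).toMonoidHom
      fun i => Subgroup.subset_normalClosure ⟨i, rfl⟩
    refine Subgroup.normalClosure_le_normal ?_
    rintro _ (rfl | rfl)
    · simpa using h (β₀ (of ⟨0, by omega⟩))
    · simpa using h (β₀ (of ⟨1, by omega⟩))

end ArtinBase
end

section
/- Let ψ_n : F_n → SL(2,ℤ) be the homomorphism with ψ_n(t_i) = [[1,1],[0,1]] for i odd and ψ_n(t_i) = [[1,0],[−1,1]] for i even, and let φ_n : F_n → Br_3 = ⟨a, b | aba = bab⟩ be the homomorphism with φ_n(t_i) = a for i odd and φ_n(t_i) = b for i even. Then the stabilizers coincide: { β ∈ Br_n : ψ_n ∘ β = ψ_n } = { β ∈ Br_n : φ_n ∘ β = φ_n }. -/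
open FreeGroup

namespace ArtinBase

/-- The single braid relation `aba (bab)⁻¹` defining `Br_3 = ⟨a, b | aba = bab⟩`
(with `a = of 0`, `b = of 1`). -/
def br3Rels : Set (FreeGroup (Fin 2)) :=
  {of (0 : Fin 2) * of (1 : Fin 2) * of (0 : Fin 2) *
    (of (1 : Fin 2) * of (0 : Fin 2) * of (1 : Fin 2))⁻¹}

abbrev Br3 := PresentedGroup br3Rels

/-- `φ_n : F_n → Br_3`, `t_i ↦ a` for paper-odd `i` (0-indexed even) and `t_i ↦ b`
otherwise. -/
def φmap (n : ℕ) : FreeGroup (Fin n) →* Br3 :=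
  FreeGroup.lift fun i =>
    if (i : ℕ) % 2 = 0 then PresentedGroup.of (0 : Fin 2) else PresentedGroup.of (1 : Fin 2)

/-- The matrix `[[1,1],[0,1]]` as an element of `SL(2,ℤ)`. -/
def Umat : Matrix.SpecialLinearGroup (Fin 2) ℤ :=
  ⟨!![1, 1; 0, 1], by norm_num [Matrix.det_fin_two_of]⟩

/-- The matrix `[[1,0],[−1,1]]` as an element of `SL(2,ℤ)`. -/
def Lmat : Matrix.SpecialLinearGroup (Fin 2) ℤ :=
  ⟨!![1, 0; -1, 1], by norm_num [Matrix.det_fin_two_of]⟩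

/-- `ψ_n : F_n → SL(2,ℤ)`, `t_i ↦ [[1,1],[0,1]]` for paper-odd `i` (0-indexed even) and
`t_i ↦ [[1,0],[−1,1]]` otherwise. -/
def ψmap (n : ℕ) : FreeGroup (Fin n) →* Matrix.SpecialLinearGroup (Fin 2) ℤ :=
  FreeGroup.lift fun i => if (i : ℕ) % 2 = 0 then Umat else Lmat

namespace Br3

/-- The generator `a` of `Br_3`. -/
def a : Br3 := PresentedGroup.of 0

/-- The generator `b` of `Br_3`. -/
def b : Br3 := PresentedGroup.of 1

theorem braid_relation : a * b * a = b * a * b := by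
  have h : PresentedGroup.mk br3Rels (of (0 : Fin 2) * of (1 : Fin 2) * of (0 : Fin 2) *
      (of (1 : Fin 2) * of (0 : Fin 2) * of (1 : Fin 2))⁻¹) = 1 :=
    PresentedGroup.one_of_mem rfl
  rw [_root_.map_mul, _root_.map_inv, mul_inv_eq_one] at h
  exact h

theorem closure_a_b : Subgroup.closure {a, b} = ⊤ := by
  rw [← PresentedGroup.closure_range_of br3Rels]
  congr 1
  ext g
  simp only [Set.mem_insert_iff, Set.mem_singleton_iff, Set.mem_range, Fin.exists_fin_two, a, b,
    eq_comm]

/-- The homomorphism to `ℤ` sending both generators to `1`. -/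
def deg : Br3 →* Multiplicative ℤ :=
  PresentedGroup.toGroup (f := fun _ => Multiplicative.ofAdd 1) (by
    rintro r rfl
    simp)

/-- The quotient map `Br_3 → SL(2,ℤ)`. -/
def toSL : Br3 →* Matrix.SpecialLinearGroup (Fin 2) ℤ :=
  PresentedGroup.toGroup (f := ![Umat, Lmat]) (by
    rintro r rfl
    simp only [_root_.map_mul, _root_.map_inv, FreeGroup.lift_apply_of, mul_inv_eq_one]
    decide)

@[simp] theorem deg_a : deg a = Multiplicative.ofAdd 1 := PresentedGroup.toGroup.of _
@[simp] theorem deg_b : deg b = Multiplicative.ofAdd 1 := PresentedGroup.toGroup.of _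
@[simp] theorem toSL_a : toSL a = Umat := PresentedGroup.toGroup.of _
@[simp] theorem toSL_b : toSL b = Lmat := PresentedGroup.toGroup.of _

/-- The Garside half-twist `aba`. -/
def x : Br3 := a * b * a

/-- The element `ab`, a cube root of the full twist. -/
def y : Br3 := a * b

/-- The full twist `(aba)²`. -/
def c : Br3 := x * x

theorem x_eq_y_mul_a : x = y * a := rfl

theorem x_eq_b_mul_y : x = b * y := by
  rw [x, braid_relation, y, mul_assoc]

theorem y_cubed : y * y * y = c := by
  have h : y * y * y = y * a * (b * y) := by simp only [y, mul_assoc]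
  rw [h, ← x_eq_b_mul_y, ← x_eq_y_mul_a, c]

theorem commute_c (g : Br3) : Commute c g := by
  have hx : Commute c x := by simp [c, Commute, SemiconjBy, mul_assoc]
  have hy : Commute c y := by simp [← y_cubed, Commute, SemiconjBy, mul_assoc]
  have ha : Commute c a := by
    have : a = y⁻¹ * x := by rw [x_eq_y_mul_a]; group
    rw [this]
    exact hy.inv_right.mul_right hx
  have hb : Commute c b := by
    have : b = x * y⁻¹ := by rw [x_eq_b_mul_y]; group
    rw [this]
    exact hx.mul_right hy.inv_right
  have hg : g ∈ Subgroup.closure {a, b} := closure_a_b ▸ Subgroup.mem_top g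
  induction hg using Subgroup.closure_induction with
  | mem g hg => rcases hg with rfl | rfl <;> assumption
  | one => exact Commute.one_right c
  | mul g h _ _ hg hh => exact hg.mul_right hh
  | inv g _ hg => exact hg.inv_right

theorem mul_c_zpow_mul (g h : Br3) (k : ℤ) : g * (c ^ k * h) = c ^ k * (g * h) := by
  rw [← mul_assoc, ← ((commute_c g).zpow_left k).eq, mul_assoc]

/-- The positive word in `a⁻¹` and `b` spelled by a list of Booleans. -/
def word (l : List Bool) : Br3 := (l.map fun i => if i then a⁻¹ else b).prod

theorem word_nil : word [] = 1 := rfl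

theorem word_cons_true (l : List Bool) : word (true :: l) = a⁻¹ * word l := by simp [word]

theorem word_cons_false (l : List Bool) : word (false :: l) = b * word l := by simp [word]

/-- Normal form of `Br_3` as a central extension of `ℤ/2 * ℤ/3`. -/
def HasNormalForm (g : Br3) : Prop :=
  ∃ (k : ℤ) (l : List Bool) (u v : Br3), (u = 1 ∨ u = y ∨ u = y⁻¹) ∧ (v = 1 ∨ v = x) ∧
    g = c ^ k * (u * (word l * v))

theorem HasNormalForm.c_zpow_mul {g : Br3} (hg : HasNormalForm g) (j : ℤ) :
    HasNormalForm (c ^ j * g) := by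
  obtain ⟨k, l, u, v, hu, hv, rfl⟩ := hg
  exact ⟨j + k, l, u, v, hu, hv, by rw [zpow_add, mul_assoc]⟩

theorem HasNormalForm.y_mul {g : Br3} (hg : HasNormalForm g) : HasNormalForm (y * g) := by
  obtain ⟨k, l, u, v, hu, hv, rfl⟩ := hg
  rw [mul_c_zpow_mul]
  apply HasNormalForm.c_zpow_mul
  rcases hu with rfl | rfl | rfl
  · exact ⟨0, l, y, v, by simp, hv, by simp⟩
  · exact ⟨1, l, y⁻¹, v, by simp, hv, by
      rw [zpow_one, ← y_cubed]
      group⟩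
  · exact ⟨0, l, 1, v, by simp, hv, by simp⟩

theorem HasNormalForm.x_mul {g : Br3} (hg : HasNormalForm g) : HasNormalForm (x * g) := by
  obtain ⟨k, l, u, v, hu, hv, rfl⟩ := hg
  rw [mul_c_zpow_mul]
  apply HasNormalForm.c_zpow_mul
  rcases hu with rfl | rfl | rfl
  · rcases l with _ | ⟨_ | _, l⟩
    · rcases hv with rfl | rfl
      · exact ⟨0, [], 1, x, by simp, by simp, by simp [word_nil]⟩
      · exact ⟨1, [], 1, 1, by simp, by simp, by simp [word_nil, c]⟩
    · refine ⟨1, l, y⁻¹, v, by simp, hv, ?_⟩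
      have h : x * b = c * y⁻¹ := by
        rw [c]
        nth_rw 3 [x_eq_b_mul_y]
        group
      rw [word_cons_false, zpow_one, one_mul, ← mul_assoc c, ← h]
      simp only [mul_assoc]
    · refine ⟨0, l, y, v, by simp, hv, ?_⟩
      rw [word_cons_true, x_eq_y_mul_a]
      group
  · refine ⟨1, true :: l, 1, v, by simp, hv, ?_⟩
    have h : x * y = c * a⁻¹ := by
      rw [c]
      nth_rw 3 [x_eq_y_mul_a]
      group
    rw [word_cons_true, zpow_one, one_mul, ← mul_assoc, h]
    simp only [mul_assoc]
  · refine ⟨0, false :: l, 1, v, by simp, hv, ?_⟩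
    rw [word_cons_false, x_eq_b_mul_y]
    group

theorem HasNormalForm.x_inv_mul {g : Br3} (hg : HasNormalForm g) : HasNormalForm (x⁻¹ * g) := by
  have h : x⁻¹ * g = c ^ (-1 : ℤ) * (x * g) := by
    rw [c]
    group
  exact h ▸ hg.x_mul.c_zpow_mul _

theorem HasNormalForm.y_inv_mul {g : Br3} (hg : HasNormalForm g) : HasNormalForm (y⁻¹ * g) := by
  have h : y⁻¹ * g = c ^ (-1 : ℤ) * (y * (y * g)) := by
    rw [← y_cubed]
    group
  exact h ▸ hg.y_mul.y_mul.c_zpow_mul _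

theorem hasNormalForm (g : Br3) : HasNormalForm g := by
  have ha : a = y⁻¹ * x := by rw [x_eq_y_mul_a]; group
  have hb : b = x * y⁻¹ := by rw [x_eq_b_mul_y]; group
  have hg : g ∈ Subgroup.closure {a, b} := closure_a_b ▸ Subgroup.mem_top g
  induction hg using Subgroup.closure_induction_left with
  | one => exact ⟨0, [], 1, 1, by simp, by simp, by simp [word_nil]⟩
  | mul_left s hs g _ hg =>
    rcases hs with rfl | rfl
    · rw [ha, mul_assoc]
      exact hg.x_mul.y_inv_mul
    · rw [hb, mul_assoc]
      exact hg.y_inv_mul.x_mul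
  | inv_mul_cancel s hs g _ hg =>
    rcases hs with rfl | rfl
    · rw [ha, mul_inv_rev, inv_inv, mul_assoc]
      exact hg.y_mul.x_inv_mul
    · rw [hb, mul_inv_rev, inv_inv, mul_assoc]
      exact hg.x_inv_mul.y_mul

theorem toSL_c : toSL c = -1 := by
  simp only [c, x, _root_.map_mul, toSL_a, toSL_b]
  decide

theorem toSL_c_zpow (k : ℤ) : toSL (c ^ k) = 1 ∨ toSL (c ^ k) = -1 := by
  rw [map_zpow, toSL_c]
  rcases Int.even_or_odd k with h | h
  · exact Or.inl h.neg_one_zpow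
  · right
    obtain ⟨m, rfl⟩ := h
    rw [zpow_add, zpow_mul]
    simp

theorem toSL_word (l : List Bool) :
    1 ≤ (toSL (word l)).1 0 0 ∧ 1 ≤ (toSL (word l)).1 1 1 ∧ (toSL (word l)).1 0 1 ≤ 0 ∧
      (toSL (word l)).1 1 0 ≤ 0 ∧ (l = [] ∨ (toSL (word l)).1 0 1 + (toSL (word l)).1 1 0 ≤ -1) := by
  induction l with
  | nil => simp [word_nil]
  | cons i l ih =>
    obtain ⟨h₁, h₂, h₃, h₄, -⟩ := ih
    have hU : ((Umat⁻¹ : Matrix.SpecialLinearGroup (Fin 2) ℤ) : Matrix (Fin 2) (Fin 2) ℤ) =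
        !![1, -1; 0, 1] := by decide
    have hL : (Lmat : Matrix (Fin 2) (Fin 2) ℤ) = !![1, 0; -1, 1] := rfl
    cases i
    · rw [word_cons_false, _root_.map_mul, toSL_b]
      simp only [Matrix.SpecialLinearGroup.coe_mul, hL, Matrix.mul_apply, Fin.sum_univ_two]
      simp
      omega
    · rw [word_cons_true, _root_.map_mul, _root_.map_inv, toSL_a]
      simp only [Matrix.SpecialLinearGroup.coe_mul, hU, Matrix.mul_apply, Fin.sum_univ_two]
      simp
      omega

/-- The kernel of `Br_3 → SL(2,ℤ)` is contained in the cyclic group of the full twist. -/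
theorem exists_eq_c_zpow_of_toSL_eq_one {g : Br3} (hg : toSL g = 1) : ∃ k : ℤ, g = c ^ k := by
  obtain ⟨k, l, u, v, hu, hv, rfl⟩ := hasNormalForm g
  obtain ⟨h₁, h₂, h₃, h₄, h₅⟩ := toSL_word l
  have hw : toSL (word l) = (toSL u)⁻¹ * (toSL (c ^ k))⁻¹ * (toSL v)⁻¹ := by
    rw [_root_.map_mul, _root_.map_mul, _root_.map_mul] at hg
    rw [eq_mul_inv_iff_mul_eq, eq_inv_mul_iff_mul_eq]
    exact eq_inv_of_mul_eq_one_right hg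
  rw [hw] at h₁ h₂ h₃ h₄ h₅
  have hx : toSL x = Umat * Lmat * Umat := by simp [x]
  have hy : toSL y = Umat * Lmat := by simp [y]
  rcases toSL_c_zpow k with hc | hc <;> rw [hc] at h₁ h₂ h₃ h₄ h₅ <;>
    rcases hu with rfl | rfl | rfl <;> rcases hv with rfl | rfl <;>
    simp only [_root_.map_inv, _root_.map_one, hx, hy] at h₁ h₂ h₃ h₄ h₅ <;>
    first
    | exact absurd h₁ (by decide)
    | exact absurd h₂ (by decide)
    | exact absurd h₃ (by decide)
    | exact absurd h₄ (by decide)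
    | obtain rfl := h₅.resolve_right (by decide)
      exact ⟨k, by simp [word_nil]⟩

theorem eq_one_of_toSL_eq_one_of_deg_eq_one {g : Br3} (hg : toSL g = 1) (hd : deg g = 1) :
    g = 1 := by
  obtain ⟨k, rfl⟩ := exists_eq_c_zpow_of_toSL_eq_one hg
  have h : deg c = Multiplicative.ofAdd 6 := by
    simp only [c, x, _root_.map_mul, deg_a, deg_b]
    rfl
  rw [map_zpow, h, ← ofAdd_zsmul, ofAdd_eq_one, smul_eq_mul] at hd
  obtain rfl : k = 0 := by omega
  exact zpow_zero c

end Br3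

theorem toSL_φmap {n : ℕ} (w : FreeGroup (Fin n)) : Br3.toSL (φmap n w) = ψmap n w := by
  have h : Br3.toSL.comp (φmap n) = ψmap n := by
    apply FreeGroup.ext_hom
    intro i
    simp only [MonoidHom.comp_apply, φmap, ψmap, FreeGroup.lift_apply_of]
    split_ifs
    · exact Br3.toSL_a
    · exact Br3.toSL_b
  exact DFunLike.congr_fun h w

theorem deg_φmap_of {n : ℕ} (i : Fin n) :
    Br3.deg (φmap n (of i)) = Multiplicative.ofAdd 1 := by
  simp only [φmap, FreeGroup.lift_apply_of]
  split_ifs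
  · exact Br3.deg_a
  · exact Br3.deg_b

theorem deg_φmap_braid {n : ℕ} {β : MulAut (FreeGroup (Fin n))} (hβ : β ∈ BraidGroup n)
    (w : FreeGroup (Fin n)) : Br3.deg (φmap n (β w)) = Br3.deg (φmap n w) := by
  induction hβ using Subgroup.closure_induction generalizing w with
  | mem β hβ =>
    obtain ⟨i, hi, rfl⟩ := hβ
    have h : (Br3.deg.comp (φmap n)).comp (σgenN n i).toMonoidHom = Br3.deg.comp (φmap n) := by
      apply FreeGroup.ext_hom
      intro j
      rw [σgenN, dif_pos hi]
      change Br3.deg (φmap n (preArtin _ _ (of j))) = Br3.deg (φmap n (of j))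
      rw [preArtin, FreeGroup.lift_apply_of]
      split_ifs <;> simp only [_root_.map_mul, _root_.map_inv, deg_φmap_of, mul_inv_cancel_comm]
    exact DFunLike.congr_fun h w
  | one => rfl
  | mul β γ _ _ hβ hγ => rw [MulAut.mul_apply, hβ, hγ]
  | inv β _ hβ => rw [← hβ, MulAut.apply_inv_self]

/-- The stabilizer of `ψ_n` in `Br_n` coincides with the stabilizer of
`φ_n` in `Br_n`. -/
theorem statement12 (n : ℕ) :
    {β : MulAut (FreeGroup (Fin n)) | β ∈ BraidGroup n ∧ ∀ w, ψmap n (β w) = ψmap n w} =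
      {β : MulAut (FreeGroup (Fin n)) | β ∈ BraidGroup n ∧ ∀ w, φmap n (β w) = φmap n w} := by
  ext β
  refine and_congr_right fun hβ => forall_congr' fun w => ⟨fun h => ?_, fun h => ?_⟩
  · rw [← mul_inv_eq_one]
    apply Br3.eq_one_of_toSL_eq_one_of_deg_eq_one
    · rw [_root_.map_mul, _root_.map_inv, toSL_φmap, toSL_φmap, h, mul_inv_cancel]
    · rw [_root_.map_mul, _root_.map_inv, deg_φmap_braid hβ, mul_inv_cancel]
  · rw [← toSL_φmap, h, toSL_φmap]

end ArtinBase
end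

section
/- Let n ≥ 1 and l ≥ 0, and work in the braid group Br_{2n+l}. Define E_{2n,l} as the subgroup generated by the elements σ_{i,j}^{m_{ij}} for 1 ≤ i < j ≤ 2n+l, where m_{ij} = 1 if j ≤ l or if (i > l and i ≡ j mod 2), m_{ij} = 2 if i ≤ l < j, and m_{ij} = 3 if i > l and i ≢ j mod 2. Then E_{2n,l} is also generated by the set consisting of: σ_i for 1 ≤ i < l; σ_{i,i+2} for l < i ≤ 2n+l−2; σ_{i,j}² for i ≤ l < j ≤ 2n+l; and σ_i³ for l < i ≤ 2n+l−1 with i ≢ l mod 2. -/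
open FreeGroup

namespace BraidPresented

/-- The braid relations among `g` abstract Artin generators `σ_0, …, σ_{g-1}`. -/
def braidRels (g : ℕ) : Set (FreeGroup (Fin g)) :=
  { r | (∃ i j : Fin g, (i : ℕ) + 1 = (j : ℕ) ∧
          r = of i * of j * of i * (of j * of i * of j)⁻¹) ∨
        (∃ i j : Fin g, (i : ℕ) + 1 < (j : ℕ) ∧ r = of i * of j * (of j * of i)⁻¹) }

/-- The braid group on `g + 1` strands, presented by `g` Artin generators. -/
abbrev BraidP (g : ℕ) := PresentedGroup (braidRels g)

/-- The `k`-th Artin generator of the presented braid group (`1` when out of range). -/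
def pgen (g : ℕ) (k : ℕ) : BraidP g :=
  if h : k < g then PresentedGroup.of ⟨k, h⟩ else 1

/-- The band generator `σ_{i,j} = (σ_{j-1} ⋯ σ_{i+1}) σ_i (σ_{j-1} ⋯ σ_{i+1})⁻¹`
(0-indexed strands `i < j`). -/
def pband (g : ℕ) (i j : ℕ) : BraidP g :=
  (((List.range (j - (i + 1))).map fun k => pgen g (j - 1 - k)).prod) * pgen g i *
    (((List.range (j - (i + 1))).map fun k => pgen g (j - 1 - k)).prod)⁻¹


theorem pgen_commute (g : ℕ) {i j : ℕ} (h : i + 1 < j) : Commute (pgen g i) (pgen g j) := by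
  unfold pgen
  split_ifs with hi hj
  · exact PresentedGroup.mk_eq_mk_of_mul_inv_mem (Or.inr ⟨⟨i, hi⟩, ⟨j, hj⟩, h, rfl⟩)
  all_goals simp

theorem pgen_braid (g : ℕ) {i : ℕ} (h : i + 1 < g) :
    pgen g i * pgen g (i + 1) * pgen g i = pgen g (i + 1) * pgen g i * pgen g (i + 1) := by
  have hi : i < g := by omega
  simp only [pgen, hi, h, dite_true]
  exact PresentedGroup.mk_eq_mk_of_mul_inv_mem (Or.inl ⟨⟨i, hi⟩, ⟨i + 1, h⟩, rfl, rfl⟩)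

theorem pband_self_succ (g i : ℕ) : pband g i (i + 1) = pgen g i := by
  simp [pband]

theorem pband_succ (g : ℕ) {i j : ℕ} (h : i < j) :
    pband g i (j + 1) = pgen g j * pband g i j * (pgen g j)⁻¹ := by
  have hj : j + 1 - (i + 1) = (j - (i + 1)) + 1 := by omega
  have hk : ∀ k, j + 1 - 1 - (k + 1) = j - 1 - k := fun k => by omega
  simp only [pband, hj, List.range_succ_eq_map, List.map_cons, List.map_map, List.prod_cons,
    Function.comp_def, Nat.succ_eq_add_one, hk]
  simp [mul_assoc]

/-- A band generator commutes with every Artin generator supported above its strands. -/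
theorem pband_commute_pgen (g : ℕ) {i j m : ℕ} (hij : i < j) (hjm : j < m) :
    Commute (pband g i j) (pgen g m) := by
  induction j, hij using Nat.le_induction with
  | base => rw [pband_self_succ]; exact pgen_commute g hjm
  | succ j hij ih =>
    rw [pband_succ g hij]
    have hc := pgen_commute g hjm
    exact (hc.mul_left (ih (by omega))).mul_left hc.inv_left

theorem pband_add_two (g : ℕ) {i j : ℕ} (h : i < j) :
    pband g i (j + 2) = pband g j (j + 2) * pband g i j * (pband g j (j + 2))⁻¹ := by
  have hc : (pgen g (j + 1))⁻¹ * pband g i j * pgen g (j + 1) = pband g i j := by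
    rw [mul_assoc, (pband_commute_pgen g h (Nat.lt_succ_self j)).eq, inv_mul_cancel_left]
  rw [pband_succ g (show i < j + 1 by omega), pband_succ g h,
    pband_succ g (Nat.lt_succ_self j), pband_self_succ]
  conv_lhs => rw [← hc]
  group

theorem pgen_succ_eq_conj (g : ℕ) {i : ℕ} (h : i + 1 < g) :
    pgen g (i + 1) = (pband g i (i + 2))⁻¹ * pgen g i * pband g i (i + 2) := by
  rw [pband_succ g (Nat.lt_succ_self i), pband_self_succ, mul_assoc, eq_inv_mul_iff_mul_eq,
    ← mul_assoc, ← mul_assoc, pgen_braid g h]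
  group

theorem pband_pow_add_two_mem {g : ℕ} {H : Subgroup (BraidP g)} {i j m : ℕ} (hij : i < j)
    (hj : pband g j (j + 2) ∈ H) (hi : pband g i j ^ m ∈ H) : pband g i (j + 2) ^ m ∈ H := by
  rw [pband_add_two g hij, conj_pow]
  exact H.mul_mem (H.mul_mem hj hi) (H.inv_mem hj)

theorem pband_mem_of_pgen_mem {g l : ℕ} {H : Subgroup (BraidP g)}
    (hH : ∀ i, i + 2 ≤ l → pgen g i ∈ H) {i j : ℕ} (hij : i < j) (hj : j < l) :
    pband g i j ∈ H := by
  induction j, hij using Nat.le_induction with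
  | base => rw [pband_self_succ]; exact hH i hj
  | succ j hij ih =>
    rw [pband_succ g hij]
    have hg := hH j hj
    exact H.mul_mem (H.mul_mem hg (ih (by omega))) (H.inv_mem hg)

/-- If `H` contains the bands of length two on the strands `l, …, N - 1`, then membership of
the `m`-th power of a band in `H` depends only on its first strand and the parity of its length. -/
theorem pband_pow_mem_of_base {g l N m : ℕ} {H : Subgroup (BraidP g)}
    (h2 : ∀ i, l ≤ i → i + 2 < N → pband g i (i + 2) ∈ H) {i s : ℕ} (hli : l ≤ i) (his : i < s)
    (hs : pband g i s ^ m ∈ H) (k : ℕ) (hk : s + 2 * k < N) :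
    pband g i (s + 2 * k) ^ m ∈ H := by
  induction k with
  | zero => exact hs
  | succ k ih =>
    have hlt : i < s + 2 * k := by omega
    exact pband_pow_add_two_mem hlt (h2 (s + 2 * k) (by omega) (by omega)) (ih (by omega))

/-- If `H` contains the bands of length two on the strands `l, …, N - 1` and the `m`-th power of
the Artin generator `σ_l`, then it contains the `m`-th powers of all Artin generators on these
strands. -/
theorem pgen_pow_mem {g l N m : ℕ} {H : Subgroup (BraidP g)} (hN : N ≤ g + 1)
    (h2 : ∀ i, l ≤ i → i + 2 < N → pband g i (i + 2) ∈ H) {i : ℕ} (hli : l ≤ i)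
    (hl : pgen g l ^ m ∈ H) (hi : i + 1 < N) : pgen g i ^ m ∈ H := by
  induction i, hli using Nat.le_induction with
  | base => exact hl
  | succ i hli ih =>
    have hb := h2 i hli hi
    have hpow := conj_pow (i := m) (a := (pband g i (i + 2))⁻¹) (b := pgen g i)
    rw [inv_inv] at hpow
    rw [pgen_succ_eq_conj g (i := i) (by omega), hpow]
    exact H.mul_mem (H.mul_mem (H.inv_mem hb) (ih (by omega))) hb

/-- In `Br_{2n+l}` the subgroup `E_{2n,l}` generated by the band powers
`σ_{i,j}^{m_{ij}}` is also generated by the listed smaller family (all indices 0-indexed: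
a paper index `i` corresponds to `i₀ = i − 1`). -/
theorem statement14 (n l : ℕ) (hn : 1 ≤ n) :
    Subgroup.closure
      {x : BraidP (2 * n + l - 1) | ∃ i j : ℕ, i < j ∧ j < 2 * n + l ∧
        (((j < l ∨ (l ≤ i ∧ i % 2 = j % 2)) ∧ x = pband (2 * n + l - 1) i j) ∨
         ((i < l ∧ l ≤ j) ∧ x = pband (2 * n + l - 1) i j ^ 2) ∨
         ((l ≤ i ∧ i % 2 ≠ j % 2) ∧ x = pband (2 * n + l - 1) i j ^ 3))} =
    Subgroup.closure
      {x : BraidP (2 * n + l - 1) |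
        (∃ i : ℕ, i + 2 ≤ l ∧ x = pband (2 * n + l - 1) i (i + 1)) ∨
        (∃ i : ℕ, l ≤ i ∧ i + 2 < 2 * n + l ∧ x = pband (2 * n + l - 1) i (i + 2)) ∨
        (∃ i j : ℕ, i < l ∧ l ≤ j ∧ j < 2 * n + l ∧ x = pband (2 * n + l - 1) i j ^ 2) ∨
        (∃ i : ℕ, l ≤ i ∧ i + 1 < 2 * n + l ∧ (i + 1) % 2 ≠ l % 2 ∧
          x = pband (2 * n + l - 1) i (i + 1) ^ 3)} := by
  apply le_antisymm
  · rw [Subgroup.closure_le]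
    set H := Subgroup.closure {x : BraidP (2 * n + l - 1) | _ ∨ _}
    have h1 : ∀ i, i + 2 ≤ l → pgen (2 * n + l - 1) i ∈ H := fun i hi =>
      Subgroup.subset_closure (Or.inl ⟨i, hi, (pband_self_succ _ i).symm⟩)
    have h2 : ∀ i, l ≤ i → i + 2 < 2 * n + l → pband (2 * n + l - 1) i (i + 2) ∈ H :=
      fun i hi hi' => Subgroup.subset_closure (Or.inr (Or.inl ⟨i, hi, hi', rfl⟩))
    have h3 : pgen (2 * n + l - 1) l ^ 3 ∈ H :=
      Subgroup.subset_closure (Or.inr (Or.inr (Or.inr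
        ⟨l, le_rfl, by omega, by omega, by rw [pband_self_succ]⟩)))
    rintro x ⟨i, j, hij, hj, ⟨hjl | ⟨hli, hpar⟩, rfl⟩ | ⟨⟨hil, hlj⟩, rfl⟩ | ⟨⟨hli, hpar⟩, rfl⟩⟩
    · exact pband_mem_of_pgen_mem h1 hij hjl
    · obtain ⟨k, rfl⟩ : ∃ k, j = i + 2 + 2 * k := ⟨(j - i - 2) / 2, by omega⟩
      have hb := h2 i hli (by omega)
      rw [← pow_one (pband _ i (i + 2))] at hb
      simpa using pband_pow_mem_of_base h2 hli (by omega) hb k hj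
    · exact Subgroup.subset_closure (Or.inr (Or.inr (Or.inl ⟨i, j, hil, hlj, hj, rfl⟩)))
    · obtain ⟨k, rfl⟩ : ∃ k, j = i + 1 + 2 * k := ⟨(j - i - 1) / 2, by omega⟩
      have hc := pgen_pow_mem (by omega) h2 hli h3 (by omega)
      rw [← pband_self_succ] at hc
      exact pband_pow_mem_of_base h2 hli (by omega) hc k hj
  · apply Subgroup.closure_mono
    rintro x (⟨i, hi, rfl⟩ | ⟨i, hi, hi', rfl⟩ | ⟨i, j, hi, hj, hj', rfl⟩ | ⟨i, hi, hi', -, rfl⟩)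
    · exact ⟨i, i + 1, by omega, by omega, Or.inl ⟨Or.inl (by omega), rfl⟩⟩
    · exact ⟨i, i + 2, by omega, by omega, Or.inl ⟨Or.inr ⟨hi, by omega⟩, rfl⟩⟩
    · exact ⟨i, j, by omega, hj', Or.inr (Or.inl ⟨⟨hi, hj⟩, rfl⟩)⟩
    · exact ⟨i, i + 1, by omega, hi', Or.inr (Or.inr ⟨⟨hi, by omega⟩, rfl⟩)⟩

end BraidPresented
end

section
/- In the braid group Br_n define, for 1 ≤ i < j ≤ n, the element σ̌_{i,j} := (Π_{j'=i+1}^{j−1} σ_{i,j'}²) · σ_{i,j} · (Π_{j'=i+1}^{j−1} σ_{i,j'}²)^{-1}, the products taken with j' increasing. Then the subgroup of Br_n generated by { σ_{i,i+1}³ : 1 ≤ i < n } ∪ { σ_{i,j}² : 1 ≤ i < j ≤ n, j − i ≥ 2 } equals the subgroup generated by { σ_{i,i+1}³ : 1 ≤ i < n } ∪ { σ_{i,i+1}^{-2} · σ̌_{i,j}² · σ_{i,i+1}² : 1 ≤ i, i+1 < j ≤ n }. -/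
open FreeGroup

namespace BraidPresented

/-- `σ̌_{i,j} := (Π_{j'=i+1}^{j−1} σ_{i,j'}²) · σ_{i,j} · (Π_{j'=i+1}^{j−1} σ_{i,j'}²)⁻¹`,
the products taken with `j'` increasing (0-indexed strands). -/
def pcheck (g : ℕ) (i j : ℕ) : BraidP g :=
  (((List.range (j - 1 - i)).map fun t => pband g i (i + 1 + t) ^ 2).prod) * pband g i j *
    (((List.range (j - 1 - i)).map fun t => pband g i (i + 1 + t) ^ 2).prod)⁻¹

/-- A subgroup contains the partial products `f 0 ⋯ f (m - 1)` as soon as it contains the factors. -/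
theorem list_range_prod_mem {G : Type*} [Group G] (H : Subgroup G) (f : ℕ → G) (m : ℕ)
    (h : ∀ t < m, f t ∈ H) : ((List.range m).map f).prod ∈ H := by
  apply Subgroup.list_prod_mem
  intro x hx
  obtain ⟨t, ht, rfl⟩ := List.mem_map.mp hx
  exact h t (List.mem_range.mp ht)

/-- The factor `σ_{i,i+1}²` of `σ̌_{i,j}` cancels after conjugation. -/
theorem conj_pcheck_sq (g i m : ℕ) :
    (pband g i (i + 1) ^ 2)⁻¹ * pcheck g i (i + 2 + m) ^ 2 * pband g i (i + 1) ^ 2 =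
      ((List.range m).map fun t => pband g i (i + 2 + t) ^ 2).prod * pband g i (i + 2 + m) ^ 2 *
        (((List.range m).map fun t => pband g i (i + 2 + t) ^ 2).prod)⁻¹ := by
  have hm : i + 2 + m - 1 - i = m + 1 := by omega
  have hf : ((List.range (m + 1)).map fun t => pband g i (i + 1 + t) ^ 2).prod =
      pband g i (i + 1) ^ 2 * ((List.range m).map fun t => pband g i (i + 2 + t) ^ 2).prod := by
    rw [List.prod_range_succ']
    have h (t : ℕ) : i + 1 + (t + 1) = i + 2 + t := by omega
    simp only [h, Nat.succ_eq_add_one, add_zero]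
  rw [pcheck, hm, hf, conj_pow]
  group

/-- In `Br_n` the subgroup generated by the `σ_{i,i+1}³` and the
`σ_{i,j}²` (`j − i ≥ 2`) equals the subgroup generated by the `σ_{i,i+1}³` and the
`σ_{i,i+1}⁻² σ̌_{i,j}² σ_{i,i+1}²` (`j − i ≥ 2`); all 0-indexed, strands `< n`. -/
theorem statement15 (n : ℕ) :
    Subgroup.closure
      ({x : BraidP (n - 1) | ∃ i : ℕ, i + 1 < n ∧ x = pband (n - 1) i (i + 1) ^ 3} ∪
       {x : BraidP (n - 1) | ∃ i j : ℕ, i + 2 ≤ j ∧ j < n ∧ x = pband (n - 1) i j ^ 2}) =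
    Subgroup.closure
      ({x : BraidP (n - 1) | ∃ i : ℕ, i + 1 < n ∧ x = pband (n - 1) i (i + 1) ^ 3} ∪
       {x : BraidP (n - 1) | ∃ i j : ℕ, i + 2 ≤ j ∧ j < n ∧
          x = (pband (n - 1) i (i + 1) ^ 2)⁻¹ * pcheck (n - 1) i j ^ 2 *
                pband (n - 1) i (i + 1) ^ 2}) := by
  apply le_antisymm
  · rw [Subgroup.closure_le]
    rintro x (hx | ⟨i, j, hij, hj, rfl⟩)
    · exact Subgroup.subset_closure (Or.inl hx)
    · obtain ⟨m, rfl⟩ := Nat.exists_eq_add_of_le hij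
      induction m using Nat.strong_induction_on with
      | _ m ih =>
        have hP := list_range_prod_mem _ (fun t => pband (n - 1) i (i + 2 + t) ^ 2) m
          fun t ht => ih t ht (by omega) (by omega)
        rw [SetLike.mem_coe, ← Subgroup.mul_mem_cancel_left _ hP,
          ← Subgroup.mul_mem_cancel_right _ (inv_mem hP), ← conj_pcheck_sq]
        exact Subgroup.subset_closure (Or.inr ⟨i, _, hij, hj, rfl⟩)
  · rw [Subgroup.closure_le]
    rintro x (hx | ⟨i, j, hij, hj, rfl⟩)
    · exact Subgroup.subset_closure (Or.inl hx)
    · obtain ⟨m, rfl⟩ := Nat.exists_eq_add_of_le hij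
      rw [conj_pcheck_sq]
      have hb : ∀ t ≤ m, pband (n - 1) i (i + 2 + t) ^ 2 ∈ Subgroup.closure
          ({x : BraidP (n - 1) | ∃ i : ℕ, i + 1 < n ∧ x = pband (n - 1) i (i + 1) ^ 3} ∪
           {x : BraidP (n - 1) | ∃ i j : ℕ, i + 2 ≤ j ∧ j < n ∧ x = pband (n - 1) i j ^ 2}) :=
        fun t ht => Subgroup.subset_closure (Or.inr ⟨i, i + 2 + t, by omega, by omega, rfl⟩)
      have hP := list_range_prod_mem _ (fun t => pband (n - 1) i (i + 2 + t) ^ 2) m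
        fun t ht => hb t ht.le
      exact mul_mem (mul_mem hP (hb m le_rfl)) (inv_mem hP)

end BraidPresented
end

section
/- Let G be a group and let S_1 ⊆ S_2 ⊆ ⋯ ⊆ S_n = S and T_1 ⊆ T_2 ⊆ ⋯ ⊆ T_n = T be two finitely filtered subsets of G (with S_0 = T_0 = ∅). Assume: (i) T_1 = S_1; (ii) for every k and every t ∈ T_k ∖ T_{k−1} there exist s ∈ S_k and an element g of the subgroup generated by S_{k−1} with t = g s g^{-1}; (iii) for every k and every s ∈ S_k ∖ S_{k−1} there exist t ∈ T_k and an element g of the subgroup generated by S_{k−1} with s = g t g^{-1}. Then S and T generate the same subgroup of G; indeed ⟨S_k⟩ = ⟨T_k⟩ for every k. -/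
/-- Criterion for two filtered subsets of a group to generate the same
subgroup: if `T 1 = S 1`, every new element of `T k` is conjugate by an element of
`⟨S (k−1)⟩` to an element of `S k`, and every new element of `S k` is conjugate by an
element of `⟨S (k−1)⟩` to an element of `T k`, then `⟨S k⟩ = ⟨T k⟩` for all `k ≤ n`;
in particular `S = S n` and `T = T n` generate the same subgroup. -/
theorem statement18 {G : Type*} [Group G] (n : ℕ) (hn : 1 ≤ n) (S T : ℕ → Set G)
    (hS0 : S 0 = ∅) (hT0 : T 0 = ∅)
    (hSmono : ∀ k, k + 1 ≤ n → S k ⊆ S (k + 1))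
    (hTmono : ∀ k, k + 1 ≤ n → T k ⊆ T (k + 1))
    (h1 : T 1 = S 1)
    (h2 : ∀ k, 1 ≤ k → k ≤ n → ∀ t ∈ T k, t ∉ T (k - 1) →
      ∃ s ∈ S k, ∃ g ∈ Subgroup.closure (S (k - 1)), t = g * s * g⁻¹)
    (h3 : ∀ k, 1 ≤ k → k ≤ n → ∀ s ∈ S k, s ∉ S (k - 1) →
      ∃ t ∈ T k, ∃ g ∈ Subgroup.closure (S (k - 1)), s = g * t * g⁻¹) :
    ∀ k ≤ n, Subgroup.closure (S k) = Subgroup.closure (T k) := by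
  intro k
  induction k with
  | zero => intro _; rw [hS0, hT0]
  | succ k ih =>
    intro hk
    have hST := ih (by omega)
    have hS := Subgroup.closure_mono (hSmono k hk)
    have hT := Subgroup.closure_mono (hTmono k hk)
    apply le_antisymm
    · rw [Subgroup.closure_le]
      intro s hs
      by_cases hsk : s ∈ S k
      · exact hT (hST ▸ Subgroup.subset_closure hsk)
      · obtain ⟨t, ht, g, hg, rfl⟩ := h3 (k + 1) (by omega) hk s hs hsk
        have hg' : g ∈ Subgroup.closure (T (k + 1)) := hT (hST ▸ hg)
        exact mul_mem (mul_mem hg' (Subgroup.subset_closure ht)) (inv_mem hg')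
    · rw [Subgroup.closure_le]
      intro t ht
      by_cases htk : t ∈ T k
      · exact hS (hST ▸ Subgroup.subset_closure htk)
      · obtain ⟨s, hs, g, hg, rfl⟩ := h2 (k + 1) (by omega) hk t ht htk
        have hg' : g ∈ Subgroup.closure (S (k + 1)) := hS hg
        exact mul_mem (mul_mem hg' (Subgroup.subset_closure hs)) (inv_mem hg')
end

section
/- Let A, B, C, D, E be points of the Euclidean plane ℝ² with A ≠ B, A ≠ C and B ≠ C. Assume: (1) B and D lie strictly on opposite sides of the line through A and C; (2) A and D lie strictly on opposite sides of the line through B and C; (3) E lies on the line through A and B; (4) the vector E − D is a scalar multiple of C − B (so the line through D and E is parallel to the line through B and C). Then min(dist(D,E), dist(A,E)) > min(dist(A,B), dist(B,C)). -/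
/-- If `α • (B - A) + β • (C - A) = 0` and `B` is not on the line `AC`, then `α = β = 0`. -/
theorem coeffs_eq_zero_of_notMem_line {V : Type*} [AddCommGroup V] [Module ℝ V] {A B C : V}
    (hAC : A ≠ C) (hB : B ∉ affineSpan ℝ ({A, C} : Set V)) {α β : ℝ}
    (h : α • (B - A) + β • (C - A) = 0) : α = 0 ∧ β = 0 := by
  have hα : α = 0 := by
    by_contra hα
    refine hB ((mem_affineSpan_pair_iff_exists_lineMap_eq).2 ⟨-(β / α), ?_⟩)
    rw [AffineMap.lineMap_apply_module']
    have h' : α • (B - A) = (-β) • (C - A) := by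
      rw [neg_smul]; exact eq_neg_of_add_eq_zero_left h
    have h'' : B - A = (-(β / α)) • (C - A) := by
      rw [← inv_smul_smul₀ hα (B - A), h', smul_smul]
      congr 1
      ring
    rw [← h'']
    abel
  refine ⟨hα, ?_⟩
  rw [hα, zero_smul, zero_add, smul_eq_zero, sub_eq_zero] at h
  exact h.resolve_right hAC.symm

/-- A point of a subspace strictly between two points on strictly opposite sides of it. -/
theorem exists_lineMap_mem_of_sOppSide {V : Type*} [AddCommGroup V] [Module ℝ V]
    {S : AffineSubspace ℝ V} {X Y : V} (h : S.SOppSide X Y) :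
    ∃ s : ℝ, 0 < s ∧ s < 1 ∧ AffineMap.lineMap X Y s ∈ S := by
  obtain ⟨P, hP, hw⟩ := h.exists_sbtw
  obtain ⟨s, ⟨h0, h1⟩, rfl⟩ := (sbtw_iff_mem_image_Ioo_and_ne.1 hw).1
  exact ⟨s, h0, h1, hP⟩


/-- Let `A, B, C, D, E` be points of the Euclidean plane with `A ≠ B`,
`A ≠ C`, `B ≠ C`. If `B` and `D` lie strictly on opposite sides of the line through
`A, C`; `A` and `D` lie strictly on opposite sides of the line through `B, C`; `E` lies on
the line through `A, B`; and `E − D` is a scalar multiple of `C − B`; then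
`min (dist D E) (dist A E) > min (dist A B) (dist B C)`. -/
theorem statement19 (A B C D E : EuclideanSpace ℝ (Fin 2))
    (hAB : A ≠ B) (hAC : A ≠ C) (hBC : B ≠ C)
    (h1 : (affineSpan ℝ ({A, C} : Set (EuclideanSpace ℝ (Fin 2)))).SOppSide B D)
    (h2 : (affineSpan ℝ ({B, C} : Set (EuclideanSpace ℝ (Fin 2)))).SOppSide A D)
    (h3 : E ∈ affineSpan ℝ ({A, B} : Set (EuclideanSpace ℝ (Fin 2))))
    (h4 : ∃ r : ℝ, E - D = r • (C - B)) :
    min (dist D E) (dist A E) > min (dist A B) (dist B C) := by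
  obtain ⟨s, hs0, hs1, hP⟩ := exists_lineMap_mem_of_sOppSide h1
  obtain ⟨w, hw0, hw1, hQ⟩ := exists_lineMap_mem_of_sOppSide h2
  obtain ⟨u, hu⟩ := mem_affineSpan_pair_iff_exists_lineMap_eq.1 hP
  obtain ⟨v, hv⟩ := mem_affineSpan_pair_iff_exists_lineMap_eq.1 hQ
  obtain ⟨t, ht⟩ := mem_affineSpan_pair_iff_exists_lineMap_eq.1 h3
  obtain ⟨r, hr⟩ := h4
  rw [AffineMap.lineMap_apply_module', AffineMap.lineMap_apply_module'] at hu hv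
  rw [AffineMap.lineMap_apply_module'] at ht
  have hcross : (w * (1 - s) + s * (1 - v)) • (B - A) + (s * v - w * u) • (C - A) = 0 := by
    linear_combination (norm := module) s • hv - w • hu
  have hpar : (w * t - (1 - v) + w * r) • (B - A) + (-v - w * r) • (C - A) = 0 := by
    linear_combination (norm := module) w • ht + w • hr - hv
  obtain ⟨e1, -⟩ := coeffs_eq_zero_of_notMem_line hAC h1.2.1 hcross
  obtain ⟨e2, e3⟩ := coeffs_eq_zero_of_notMem_line hAC h1.2.1 hpar
  have hv1 : 1 < v := by nlinarith [mul_pos hw0 (sub_pos.2 hs1)]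
  have ht1 : 1 < t := by nlinarith
  have hr1 : r < -1 := by nlinarith
  have hDE : dist B C < dist D E := by
    have hpos := dist_pos.2 hBC
    rw [dist_comm B C, dist_comm D E, dist_eq_norm E D, hr, norm_smul, ← dist_eq_norm,
      Real.norm_eq_abs, abs_of_neg (by linarith)]
    rw [dist_comm] at hpos
    nlinarith
  have hAE : dist A B < dist A E := by
    have hpos := dist_pos.2 hAB
    rw [dist_comm] at hpos
    rw [dist_comm A B, dist_comm A E, dist_eq_norm E A, ← ht, add_sub_cancel_right, norm_smul,
      ← dist_eq_norm, Real.norm_eq_abs, abs_of_pos (by linarith)]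
    nlinarith
  exact lt_min (min_lt_of_right_lt hDE) (min_lt_of_left_lt hAE)
end
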